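/- arXiv:1007.3385 — 7 statements merged into one kernel-verified Lean document; each statement's English description precedes it below -/
import Mathlib

section
/- Let S ⊂ ℝ be a nonempty compact set, let f₁,…,f_m : S → S be Lipschitz maps, let p = (p₁,…,p_m) be a probability vector, and define the Markov kernel N(x,·) := ∑_{i=1}^{m} p_i·δ_{f_i(x)}. Suppose there exist q ∈ (0,1] and ρ ∈ (0,1) such that for all x,y ∈ S, ∑_{i=1}^{m} p_i·|f_i(y) − f_i(x)|^q ≤ ρ·|y − x|^q, and suppose μ is an N-invariant probability measure on S (i.e. μ(B) = ∑_i p_i·μ(f_i^{-1}(B)) for every Borel set B). Then for every n ∈ ℕ and every x ∈ S, the Wasserstein distance satisfies D(N^n(x,·), μ) := sup{ |∫g dN^n(x,·) − ∫g dμ| : g : S → ℝ 1-Lipschitz } ≤ diam(S)·ρ^n. -/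
open MeasureTheory Filter Set

noncomputable section

/-- One step of the iterated-random-functions Markov kernel, acting on measures:
`ν ↦ ∑ i, p_i · (f_i)_* ν`. Its `n`-th iterate applied to `δ_x` is `N^n(x, ·)`. -/
def ifsStep {m : ℕ} (p : Fin m → ℝ) (f : Fin m → ℝ → ℝ) (ν : Measure ℝ) : Measure ℝ :=
  ∑ i : Fin m, ENNReal.ofReal (p i) • ν.map (f i)

def ifsOp {m : ℕ} (p : Fin m → ℝ) (f : Fin m → ℝ → ℝ) (h : ℝ → ℝ) : ℝ → ℝ :=
  fun x => ∑ i : Fin m, p i * h (f i x)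

lemma good_integrable (S : Set ℝ) (ν : Measure ℝ) [IsFiniteMeasure ν] (hν : ν Sᶜ = 0)
    (h : ℝ → ℝ) (hm : Measurable h) (M : ℝ) (hb : ∀ x ∈ S, |h x| ≤ M) : Integrable h ν := by
  refine Integrable.of_bound hm.aestronglyMeasurable M ?_
  have : ∀ᵐ x ∂ν, x ∈ S := hν
  filter_upwards [this] with x hx
  exact hb x hx

lemma ifsStep_finite {m : ℕ} (p : Fin m → ℝ) (f : Fin m → ℝ → ℝ) (ν : Measure ℝ)
    [IsFiniteMeasure ν] : IsFiniteMeasure (ifsStep p f ν) := by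
  refine ⟨?_⟩
  simp only [ifsStep, Measure.coe_finset_sum, Finset.sum_apply, Measure.smul_apply, smul_eq_mul]
  exact ENNReal.sum_lt_top.2 fun i _ => ENNReal.mul_lt_top ENNReal.ofReal_lt_top
    (measure_lt_top _ _)

lemma ifsStep_null {m : ℕ} (p : Fin m → ℝ) (f : Fin m → ℝ → ℝ) (hfm : ∀ i, Measurable (f i))
    (S : Set ℝ) (hSm : MeasurableSet S) (hfS : ∀ i, MapsTo (f i) S S)
    (ν : Measure ℝ) (hν : ν Sᶜ = 0) : ifsStep p f ν Sᶜ = 0 := by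
  simp only [ifsStep, Measure.coe_finset_sum, Finset.sum_apply, Measure.smul_apply, smul_eq_mul]
  refine Finset.sum_eq_zero fun i _ => ?_
  rw [Measure.map_apply (hfm i) hSm.compl, measure_mono_null _ hν, mul_zero]
  intro x hx hxS
  exact hx (hfS i hxS)

lemma ifsOp_meas {m : ℕ} (p : Fin m → ℝ) (f : Fin m → ℝ → ℝ) (hfm : ∀ i, Measurable (f i))
    (h : ℝ → ℝ) (hm : Measurable h) : Measurable (ifsOp p f h) := by
  unfold ifsOp
  exact Finset.measurable_fun_sum _ fun i _ => (hm.comp (hfm i)).const_mul _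

lemma ifsOp_bdd {m : ℕ} (p : Fin m → ℝ) (f : Fin m → ℝ → ℝ) (hp : ∀ i, 0 ≤ p i)
    (hp1 : ∑ i : Fin m, p i = 1) (S : Set ℝ) (hfS : ∀ i, MapsTo (f i) S S)
    (h : ℝ → ℝ) (M : ℝ) (hb : ∀ x ∈ S, |h x| ≤ M) : ∀ x ∈ S, |ifsOp p f h x| ≤ M := by
  intro x hx
  unfold ifsOp
  calc |∑ i : Fin m, p i * h (f i x)| ≤ ∑ i : Fin m, |p i * h (f i x)| :=
        Finset.abs_sum_le_sum_abs _ _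
    _ ≤ ∑ i : Fin m, p i * M := by
        refine Finset.sum_le_sum fun i _ => ?_
        rw [abs_mul, abs_of_nonneg (hp i)]
        exact mul_le_mul_of_nonneg_left (hb _ (hfS i hx)) (hp i)
    _ = M := by rw [← Finset.sum_mul, hp1, one_mul]

lemma ifsOp_iter {m : ℕ} (p : Fin m → ℝ) (f : Fin m → ℝ → ℝ) (hfm : ∀ i, Measurable (f i))
    (hp : ∀ i, 0 ≤ p i)
    (hp1 : ∑ i : Fin m, p i = 1) (S : Set ℝ) (hfS : ∀ i, MapsTo (f i) S S)
    (h : ℝ → ℝ) (hm : Measurable h) (M : ℝ) (hb : ∀ x ∈ S, |h x| ≤ M) (n : ℕ) :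
    Measurable ((ifsOp p f)^[n] h) ∧ ∀ x ∈ S, |(ifsOp p f)^[n] h x| ≤ M := by
  induction n with
  | zero => exact ⟨hm, hb⟩
  | succ n ih =>
    rw [Function.iterate_succ_apply']
    exact ⟨ifsOp_meas p f hfm _ ih.1, ifsOp_bdd p f hp hp1 S hfS _ M ih.2⟩

lemma integral_ifsStep {m : ℕ} (p : Fin m → ℝ) (f : Fin m → ℝ → ℝ)
    (hfm : ∀ i, Measurable (f i)) (hp : ∀ i, 0 ≤ p i)
    (S : Set ℝ) (hSm : MeasurableSet S) (hfS : ∀ i, MapsTo (f i) S S)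
    (h : ℝ → ℝ) (hm : Measurable h) (M : ℝ) (hb : ∀ x ∈ S, |h x| ≤ M)
    (ν : Measure ℝ) [IsFiniteMeasure ν] (hν : ν Sᶜ = 0) :
    ∫ y, h y ∂(ifsStep p f ν) = ∫ y, ifsOp p f h y ∂ν := by
  have hc : ∀ i, Integrable (fun x => h (f i x)) ν := fun i =>
    good_integrable S ν hν _ (hm.comp (hfm i)) M fun x hx => hb _ (hfS i hx)
  unfold ifsStep ifsOp
  rw [integral_finsetSum_measure, integral_finsetSum _ fun i _ => (hc i).const_mul _]
  · refine Finset.sum_congr rfl fun i _ => ?_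
    rw [integral_smul_measure, integral_map (hfm i).aemeasurable hm.aestronglyMeasurable,
      integral_const_mul, ENNReal.toReal_ofReal (hp i), smul_eq_mul]
  · intro i _
    refine Integrable.smul_measure ?_ ENNReal.ofReal_ne_top
    exact (integrable_map_measure hm.aestronglyMeasurable (hfm i).aemeasurable).2 (hc i)

lemma integral_iter {m : ℕ} (p : Fin m → ℝ) (f : Fin m → ℝ → ℝ)
    (hfm : ∀ i, Measurable (f i)) (hp : ∀ i, 0 ≤ p i) (hp1 : ∑ i : Fin m, p i = 1)
    (S : Set ℝ) (hSm : MeasurableSet S) (hfS : ∀ i, MapsTo (f i) S S)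
    (h : ℝ → ℝ) (hm : Measurable h) (M : ℝ) (hb : ∀ x ∈ S, |h x| ≤ M) (n : ℕ) :
    ∀ (ν : Measure ℝ) [IsFiniteMeasure ν], ν Sᶜ = 0 →
    ∫ y, h y ∂((ifsStep p f)^[n] ν) = ∫ y, (ifsOp p f)^[n] h y ∂ν := by
  induction n with
  | zero => intro ν _ _; rfl
  | succ n ih =>
    intro ν _ hν
    haveI := ifsStep_finite p f ν
    rw [Function.iterate_succ_apply, Function.iterate_succ_apply',
      ih _ (ifsStep_null p f hfm S hSm hfS ν hν)]
    obtain ⟨h1, h2⟩ := ifsOp_iter p f hfm hp hp1 S hfS h hm M hb n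
    exact integral_ifsStep p f hfm hp S hSm hfS _ h1 M h2 ν hν

lemma contr_iter {m : ℕ} (p : Fin m → ℝ) (f : Fin m → ℝ → ℝ) (hp : ∀ i, 0 ≤ p i)
    (S : Set ℝ) (hfS : ∀ i, MapsTo (f i) S S) (q ρ : ℝ) (hρ : 0 ≤ ρ)
    (hcontr : ∀ x ∈ S, ∀ y ∈ S,
        ∑ i : Fin m, p i * |f i y - f i x| ^ q ≤ ρ * |y - x| ^ q)
    (h : ℝ → ℝ) (C : ℝ) (hC : 0 ≤ C)
    (hh : ∀ x ∈ S, ∀ y ∈ S, |h y - h x| ≤ C * |y - x| ^ q) (n : ℕ) :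
    ∀ x ∈ S, ∀ y ∈ S,
      |(ifsOp p f)^[n] h y - (ifsOp p f)^[n] h x| ≤ C * ρ ^ n * |y - x| ^ q := by
  induction n with
  | zero => simpa using hh
  | succ n ih =>
    intro x hx y hy
    rw [Function.iterate_succ_apply']
    generalize (ifsOp p f)^[n] h = k at ih
    unfold ifsOp
    rw [← Finset.sum_sub_distrib]
    calc _ ≤ ∑ i : Fin m, |p i * k (f i y) - p i * k (f i x)| :=
          Finset.abs_sum_le_sum_abs _ _
      _ ≤ ∑ i : Fin m, C * ρ ^ n * (p i * |f i y - f i x| ^ q) := by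
          refine Finset.sum_le_sum fun i _ => ?_
          rw [← mul_sub, abs_mul, abs_of_nonneg (hp i)]
          have := mul_le_mul_of_nonneg_left (ih _ (hfS i hx) _ (hfS i hy)) (hp i)
          linarith
      _ = C * ρ ^ n * ∑ i : Fin m, p i * |f i y - f i x| ^ q := by rw [Finset.mul_sum]
      _ ≤ C * ρ ^ n * (ρ * |y - x| ^ q) :=
          mul_le_mul_of_nonneg_left (hcontr x hx y hy) (by positivity)
      _ = _ := by ring

/-- **Lemma (exponential convergence in Wasserstein distance).** If the IFS
`(f_i, p_i)` on a compact set `S` is `(q, ρ)`-average contracting and `μ` is an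
invariant probability measure, then for every `x ∈ S` and every `1`-Lipschitz `g`,
`|∫ g dN^n(x,·) − ∫ g dμ| ≤ diam(S)·ρⁿ`, i.e. `D(N^n(x,·), μ) ≤ diam(S)·ρⁿ`. -/
theorem ifs_wasserstein_contraction
    {m : ℕ} (S : Set ℝ) (hS : IsCompact S) (hSne : S.Nonempty)
    (f : Fin m → ℝ → ℝ)
    (hfm : ∀ i, Measurable (f i))
    (hfLip : ∀ i, ∃ K : NNReal, LipschitzOnWith K (f i) S)
    (hfS : ∀ i, MapsTo (f i) S S)
    (p : Fin m → ℝ) (hp : ∀ i, 0 ≤ p i) (hp1 : ∑ i : Fin m, p i = 1)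
    (q ρ : ℝ) (hq : q ∈ Set.Ioc (0:ℝ) 1) (hρ : ρ ∈ Set.Ioo (0:ℝ) 1)
    (hcontr : ∀ x ∈ S, ∀ y ∈ S,
        ∑ i : Fin m, p i * |f i y - f i x| ^ q ≤ ρ * |y - x| ^ q)
    (μ : Measure ℝ) (hμ : IsProbabilityMeasure μ) (hμS : μ S = 1)
    (hinv : ∀ B : Set ℝ, MeasurableSet B →
        μ B = ∑ i : Fin m, ENNReal.ofReal (p i) * μ (f i ⁻¹' B)) :
    ∀ n : ℕ, ∀ x ∈ S, ∀ g : ℝ → ℝ, LipschitzWith 1 g →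
      |(∫ y, g y ∂((ifsStep p f)^[n] (Measure.dirac x))) - ∫ y, g y ∂μ|
        ≤ Metric.diam S * ρ ^ n := by
  intro n x hx g hg
  have hSm : MeasurableSet S := hS.measurableSet
  have hgm : Measurable g := hg.continuous.measurable
  obtain ⟨M, hM⟩ := hS.exists_bound_of_continuousOn hg.continuous.continuousOn
  have hμ0 : μ Sᶜ = 0 := (prob_compl_eq_zero_iff hSm).2 hμS
  have hd0 : (Measure.dirac x) Sᶜ = 0 := by
    rw [Measure.dirac_apply' _ hSm.compl]; simp [hx]
  have hfix : ifsStep p f μ = μ := by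
    ext B hB
    rw [hinv B hB]
    simp only [ifsStep, Measure.coe_finset_sum, Finset.sum_apply, Measure.smul_apply, smul_eq_mul]
    exact Finset.sum_congr rfl fun i _ => by rw [Measure.map_apply (hfm i) hB]
  have e1 := integral_iter p f hfm hp hp1 S hSm hfS g hgm M hM n (Measure.dirac x) hd0
  have e2 := integral_iter p f hfm hp hp1 S hSm hfS g hgm M hM n μ hμ0
  rw [Function.iterate_fixed hfix] at e2
  rw [e1, e2, integral_dirac]
  obtain ⟨h1, h2⟩ := ifsOp_iter p f hfm hp hp1 S hfS g hgm M hM n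
  have hD : ∀ a ∈ S, ∀ b ∈ S, |b - a| ≤ Metric.diam S := fun a ha b hb => by
    rw [← Real.dist_eq]; exact Metric.dist_le_diam_of_mem hS.isBounded hb ha
  have hD0 : 0 ≤ Metric.diam S := Metric.diam_nonneg
  have hsplit : ∀ d : ℝ, 0 ≤ d → d = d ^ (1 - q) * d ^ q := fun d hd => by
    rw [← Real.rpow_add' hd (by simp)]; simp
  have hC : 0 ≤ Metric.diam S ^ (1 - q) := Real.rpow_nonneg hD0 _
  have hc := contr_iter p f hp S hfS q ρ hρ.1.le hcontr g (Metric.diam S ^ (1 - q)) hC (by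
    intro a ha b hb
    have l := hg.dist_le_mul b a
    rw [Real.dist_eq, Real.dist_eq, NNReal.coe_one, one_mul] at l
    refine l.trans ?_
    conv_lhs => rw [hsplit _ (abs_nonneg (b - a))]
    refine mul_le_mul_of_nonneg_right ?_ (Real.rpow_nonneg (abs_nonneg _) _)
    exact Real.rpow_le_rpow (abs_nonneg _) (hD a ha b hb) (by linarith [hq.2])) n
  have hint := good_integrable S μ hμ0 _ h1 M h2
  have e3 : (ifsOp p f)^[n] g x - ∫ y, (ifsOp p f)^[n] g y ∂μ
      = ∫ y, ((ifsOp p f)^[n] g x - (ifsOp p f)^[n] g y) ∂μ := by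
    rw [integral_sub (integrable_const _) hint]; simp
  rw [e3]
  have hae : ∀ᵐ y ∂μ, ‖(ifsOp p f)^[n] g x - (ifsOp p f)^[n] g y‖ ≤ Metric.diam S * ρ ^ n := by
    have : ∀ᵐ y ∂μ, y ∈ S := hμ0
    filter_upwards [this] with y hy
    refine (hc y hy x hx).trans ?_
    have hr : |x - y| ^ q ≤ Metric.diam S ^ q :=
      Real.rpow_le_rpow (abs_nonneg _) (hD y hy x hx) hq.1.le
    have hρn : 0 ≤ ρ ^ n := pow_nonneg hρ.1.le n
    calc _ ≤ Metric.diam S ^ (1 - q) * ρ ^ n * Metric.diam S ^ q :=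
          mul_le_mul_of_nonneg_left hr (mul_nonneg hC hρn)
      _ = (Metric.diam S ^ (1 - q) * Metric.diam S ^ q) * ρ ^ n := by ring
      _ = _ := by rw [← hsplit _ hD0]
  simpa using norm_integral_le_of_norm_le_const hae


end
end

section
/- For every i ∈ {1,…,6} and all x, y ∈ [0,1/2], |z_i(y) − z_i(x)| ≤ √(D_i(x)·D_i(y)) · |y − x|, where D₁(x) = 3/(2(1+x)²), D₂(x) = 6/(2−x)², D₃(x) = 2/(3(1−x)²), D₄(x) = 3/(2(2−x)²), D₅(x) = 3/(2(2−x)²), D₆(x) = 2/3 (so that D_i(x) = |z_i'|(x) wherever z_i is differentiable). -/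
open MeasureTheory ProbabilityTheory Filter Set

noncomputable section

/-- The six maps `z₁, …, z₆` of the flat-triangle iterated function system. -/
def zfun : Fin 6 → ℝ → ℝ :=
  ![ fun x => 3*x/(2+2*x),
     fun x => if x < 2/7 then 3*x/(2-x) else (2-4*x)/(2-x),
     fun x => if x < 1/5 then (1+x)/(3-3*x) else (2-4*x)/(3-3*x),
     fun x => (1+x)/(4-2*x),
     fun x => (1-2*x)/(4-2*x),
     fun x => (1-2*x)/3 ]

/-- The absolute values `D_i = |z_i'|` of the derivatives of the maps `z_i`. -/
def Dfun : Fin 6 → ℝ → ℝ :=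
  ![ fun x => 3/(2*(1+x)^2),
     fun x => 6/(2-x)^2,
     fun x => 2/(3*(1-x)^2),
     fun x => 3/(2*(2-x)^2),
     fun x => 3/(2*(2-x)^2),
     fun _ => 2/3 ]

theorem key_bound (d P k m t N : ℝ) (hm : 0 < m) (hk : 0 ≤ k) (hP : P = (k/m)^2)
    (hd : d = N/m) (hN : |N| ≤ k*|t|) : |d| ≤ Real.sqrt P * |t| := by
  rw [hP, Real.sqrt_sq (by positivity), hd, abs_div, abs_of_pos hm, div_mul_eq_mul_div]
  exact div_le_div_of_nonneg_right hN hm.le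

theorem abs_lin (k t N : ℝ) (hk : 0 ≤ k) (h : N = k*t ∨ N = -(k*t)) : |N| ≤ k*|t| := by
  rcases h with h | h <;> rw [h] <;> simp [abs_mul, abs_of_nonneg hk]

/-- **Geometric-mean Lipschitz bound for the maps `z_i`.** For each `i` and all
`x, y ∈ [0,1/2]`, `|z_i(y) − z_i(x)| ≤ √(D_i(x)·D_i(y))·|y − x|`. -/
theorem zfun_geometric_mean_bound :
    ∀ i : Fin 6, ∀ x ∈ Set.Icc (0:ℝ) (1/2), ∀ y ∈ Set.Icc (0:ℝ) (1/2),
      |zfun i y - zfun i x| ≤ Real.sqrt (Dfun i x * Dfun i y) * |y - x| := by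
  intro i x hx y hy
  obtain ⟨hx0, hx1⟩ := hx
  obtain ⟨hy0, hy1⟩ := hy
  have a1 : 0 < 1 + x := by linarith
  have a2 : 0 < 1 + y := by linarith
  have b1 : 0 < 2 - x := by linarith
  have b2 : 0 < 2 - y := by linarith
  have c1 : 0 < 1 - x := by linarith
  have c2 : 0 < 1 - y := by linarith
  have e1 : 2 + 2*x = 2*(1+x) := by ring
  have e2 : 2 + 2*y = 2*(1+y) := by ring
  have f1 : 3 - 3*x = 3*(1-x) := by ring
  have f2 : 3 - 3*y = 3*(1-y) := by ring
  have g1 : 4 - 2*x = 2*(2-x) := by ring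
  have g2 : 4 - 2*y = 2*(2-y) := by ring
  fin_cases i
  · change |3*y/(2+2*y) - 3*x/(2+2*x)| ≤ Real.sqrt (3/(2*(1+x)^2) * (3/(2*(1+y)^2))) * |y-x|
    rw [e1, e2]
    refine key_bound _ _ (3/2) ((1+x)*(1+y)) _ (3/2*(y-x)) (by positivity) (by norm_num) ?_ ?_
      (abs_lin _ _ _ (by norm_num) (Or.inl rfl))
    · field_simp
      try norm_num
    · field_simp
      try ring
  · change |(if y < 2/7 then 3*y/(2-y) else (2-4*y)/(2-y)) -
      (if x < 2/7 then 3*x/(2-x) else (2-4*x)/(2-x))| ≤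
      Real.sqrt (6/(2-x)^2 * (6/(2-y)^2)) * |y-x|
    refine key_bound _ _ 6 ((2-x)*(2-y)) _ (((if y < 2/7 then 3*y else 2-4*y))*(2-x) -
      (if x < 2/7 then 3*x else 2-4*x)*(2-y)) (by positivity) (by norm_num) ?_ ?_ ?_
    · field_simp
      try norm_num
    · split_ifs <;> field_simp
    · split_ifs with h1 h2 h2
      · exact abs_lin _ _ _ (by norm_num) (Or.inl (by ring))
      · rw [abs_sub_comm y x, abs_of_nonneg (a := x - y) (by linarith), abs_le]
        have p := mul_nonneg (show 0 ≤ 7*x-2 by linarith) b2.le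
        have q := mul_nonneg (show 0 ≤ 2-7*y by linarith) b1.le
        constructor <;> nlinarith
      · rw [abs_of_nonneg (a := y - x) (by linarith), abs_le]
        have p := mul_nonneg (show 0 ≤ 7*y-2 by linarith) b1.le
        have q := mul_nonneg (show 0 ≤ 2-7*x by linarith) b2.le
        constructor <;> nlinarith
      · exact abs_lin _ _ _ (by norm_num) (Or.inr (by ring))
  · change |(if y < 1/5 then (1+y)/(3-3*y) else (2-4*y)/(3-3*y)) -
      (if x < 1/5 then (1+x)/(3-3*x) else (2-4*x)/(3-3*x))| ≤
      Real.sqrt (2/(3*(1-x)^2) * (2/(3*(1-y)^2))) * |y-x|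
    rw [f1, f2]
    refine key_bound _ _ 2 (3*((1-x)*(1-y))) _ (((if y < 1/5 then 1+y else 2-4*y))*(1-x) -
      (if x < 1/5 then 1+x else 2-4*x)*(1-y)) (by positivity) (by norm_num) ?_ ?_ ?_
    · field_simp
      try norm_num
    · split_ifs <;> field_simp
    · split_ifs with h1 h2 h2
      · exact abs_lin _ _ _ (by norm_num) (Or.inl (by ring))
      · rw [abs_sub_comm y x, abs_of_nonneg (a := x - y) (by linarith), abs_le]
        have p := mul_nonneg (show 0 ≤ 5*x-1 by linarith) c2.le
        have q := mul_nonneg (show 0 ≤ 1-5*y by linarith) c1.le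
        constructor <;> nlinarith
      · rw [abs_of_nonneg (a := y - x) (by linarith), abs_le]
        have p := mul_nonneg (show 0 ≤ 5*y-1 by linarith) c1.le
        have q := mul_nonneg (show 0 ≤ 1-5*x by linarith) c2.le
        constructor <;> nlinarith
      · exact abs_lin _ _ _ (by norm_num) (Or.inr (by ring))
  · change |(1+y)/(4-2*y) - (1+x)/(4-2*x)| ≤
      Real.sqrt (3/(2*(2-x)^2) * (3/(2*(2-y)^2))) * |y-x|
    rw [g1, g2]
    refine key_bound _ _ (3/2) ((2-x)*(2-y)) _ (3/2*(y-x)) (by positivity) (by norm_num) ?_ ?_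
      (abs_lin _ _ _ (by norm_num) (Or.inl rfl))
    · field_simp
      try norm_num
    · field_simp
      try ring
  · change |(1-2*y)/(4-2*y) - (1-2*x)/(4-2*x)| ≤
      Real.sqrt (3/(2*(2-x)^2) * (3/(2*(2-y)^2))) * |y-x|
    rw [g1, g2]
    refine key_bound _ _ (3/2) ((2-x)*(2-y)) _ (-(3/2*(y-x))) (by positivity) (by norm_num) ?_ ?_
      (abs_lin _ _ _ (by norm_num) (Or.inr rfl))
    · field_simp
      try norm_num
    · field_simp
      try ring
  · change |(1-2*y)/3 - (1-2*x)/3| ≤ Real.sqrt (2/3 * (2/3)) * |y-x|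
    refine key_bound _ _ 2 3 _ (-(2*(y-x))) (by positivity) (by norm_num) (by norm_num) (by ring)
      (abs_lin _ _ _ (by norm_num) (Or.inr rfl))

end
end

section
/- There exists a constant c ∈ (0,1) such that for all x, y ∈ [0,1/2], ∏_{i,j=1}^{6} |z_i(z_j(y)) − z_i(z_j(x))| ≤ c³⁶ · |y − x|³⁶; i.e. the two-step iterated random function system (z_i ∘ z_j)_{i,j∈{1,…,6}} is contracting on average in the geometric-mean sense. -/
open MeasureTheory ProbabilityTheory Filter Set

noncomputable section

def SS (a : ℝ) : ℝ := 3 / ((1 - a^2) * (2-a)^3)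

lemma SS_mono {a b : ℝ} (ha : 0 ≤ a) (hab : a ≤ b) (hb : b ≤ 1/2) : SS a ≤ SS b := by
  unfold SS
  have h1 : 0 < 1 - b^2 := by nlinarith
  have h2 : 0 < 2 - b := by linarith
  have h3 : 0 < 1 - a^2 := by nlinarith
  gcongr

lemma SS_pos {a : ℝ} (ha : 0 ≤ a) (hb : a ≤ 1/2) : 0 < SS a := by
  unfold SS
  have h1 : 0 < 1 - a^2 := by nlinarith
  have h2 : 0 < 2 - a := by linarith
  positivity

lemma fold_eq2 {x : ℝ} (hb : x ≤ 1/2) :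
    zfun 1 x = min (3*x/(2-x)) (1 - 3*x/(2-x)) := by
  have h2 : 0 < 2 - x := by linarith
  have e : (2-4*x)/(2-x) = 1 - 3*x/(2-x) := by field_simp; ring
  simp only [zfun, Matrix.cons_val, ← e]
  split_ifs with h
  · rw [min_eq_left]; gcongr; linarith
  · rw [min_eq_right]; push Not at h; gcongr; linarith

lemma fold_eq3 {x : ℝ} (hb : x ≤ 1/2) :
    zfun 2 x = min ((1+x)/(3-3*x)) (1 - (1+x)/(3-3*x)) := by
  have h2 : 0 < 3 - 3*x := by linarith
  have e : (2-4*x)/(3-3*x) = 1 - (1+x)/(3-3*x) := by rw [eq_sub_iff_add_eq, ← add_div, div_eq_one_iff_eq h2.ne']; ring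
  simp only [zfun, Matrix.cons_val, ← e]
  split_ifs with h
  · rw [min_eq_left]; gcongr ?_ / _; linarith
  · rw [min_eq_right]; push Not at h; gcongr ?_ / _; linarith

lemma fold_le (u v : ℝ) : |min u (1-u) - min v (1-v)| ≤ |u - v| := by
  rcases le_total u (1-u) with h | h <;> rcases le_total v (1-v) with h' | h' <;>
  simp only [min_eq_left, min_eq_right, h, h'] <;> rw [abs_le] <;>
  rcases abs_cases (u-v) with ⟨e, _⟩ | ⟨e, _⟩ <;> rw [e] <;> constructor <;> linarith

lemma z_mem {x : ℝ} (ha : 0 ≤ x) (hb : x ≤ 1/2) (j : Fin 6) : 0 ≤ zfun j x ∧ zfun j x ≤ 1/2 := by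
  have h1 : 0 < 2 + 2*x := by linarith
  have h2 : 0 < 2 - x := by linarith
  have h3 : 0 < 3 - 3*x := by linarith
  have h4 : 0 < 4 - 2*x := by linarith
  fin_cases j <;> simp only [zfun, Fin.mk_one, Fin.zero_eta, Fin.reduceFinMk, Matrix.cons_val] <;>
    (try split_ifs with h) <;> refine ⟨div_nonneg (by linarith) (by linarith), ?_⟩ <;>
    (rw [div_le_iff₀ (by linarith)]; linarith)

lemma one_step {a b : ℝ} (ha : 0 ≤ a) (ha' : a ≤ 1/2) (hb : 0 ≤ b) (hb' : b ≤ 1/2) :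
    ∏ i : Fin 6, |zfun i b - zfun i a| ≤ |b - a|^6 * SS a * SS b := by
  have p1 : 0 < 1 + a := by linarith
  have p2 : 0 < 2 - a := by linarith
  have p3 : 0 < 1 - a := by linarith
  have q1 : 0 < 1 + b := by linarith
  have q2 : 0 < 2 - b := by linarith
  have q3 : 0 < 1 - b := by linarith
  have k (u c : ℝ) (hc : 0 < c) (e : u = (b - a) * c ∨ u = -((b - a) * c)) : |u| = |b - a| * c := by
    rcases e with e | e <;> rw [e] <;> simp [abs_mul, abs_of_pos hc]
  have r0 : |zfun 0 b - zfun 0 a| = |b-a| * (3/(2*(1+a)*(1+b))) := by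
    apply k _ _ (by positivity); left
    simp only [zfun, Matrix.cons_val]
    rw [show 2+2*b = 2*(1+b) by ring, show 2+2*a = 2*(1+a) by ring]
    field_simp; ring
  have r1 : |zfun 1 b - zfun 1 a| ≤ |b-a| * (6/((2-a)*(2-b))) := by
    rw [fold_eq2 ha', fold_eq2 hb']
    refine (fold_le _ _).trans (le_of_eq ?_)
    apply k _ _ (by positivity); left
    field_simp; ring
  have r2 : |zfun 2 b - zfun 2 a| ≤ |b-a| * (2/(3*(1-a)*(1-b))) := by
    rw [fold_eq3 ha', fold_eq3 hb']
    refine (fold_le _ _).trans (le_of_eq ?_)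
    apply k _ _ (by positivity); left
    rw [show 3-3*b = 3*(1-b) by ring, show 3-3*a = 3*(1-a) by ring]
    field_simp; ring
  have r3 : |zfun 3 b - zfun 3 a| = |b-a| * (3/(2*(2-a)*(2-b))) := by
    apply k _ _ (by positivity); left
    simp only [zfun, Matrix.cons_val]
    rw [show 4-2*b = 2*(2-b) by ring, show 4-2*a = 2*(2-a) by ring]
    field_simp; ring
  have r4 : |zfun 4 b - zfun 4 a| = |b-a| * (3/(2*(2-a)*(2-b))) := by
    apply k _ _ (by positivity); right
    simp only [zfun, Matrix.cons_val]
    rw [show 4-2*b = 2*(2-b) by ring, show 4-2*a = 2*(2-a) by ring]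
    field_simp; ring
  have r5 : |zfun 5 b - zfun 5 a| = |b-a| * (2/3) := by
    apply k _ _ (by positivity); right
    simp only [zfun, Matrix.cons_val]
    ring
  rw [Fin.prod_univ_six, r0, r3, r4, r5]
  calc _ ≤ |b-a| * (3/(2*(1+a)*(1+b))) * (|b-a| * (6/((2-a)*(2-b)))) * (|b-a| * (2/(3*(1-a)*(1-b))))
        * (|b-a| * (3/(2*(2-a)*(2-b)))) * (|b-a| * (3/(2*(2-a)*(2-b)))) * (|b-a| * (2/3)) := by
        gcongr
    _ = _ := by
      unfold SS
      rw [show 1 - a^2 = (1-a)*(1+a) by ring, show 1 - b^2 = (1-b)*(1+b) by ring]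
      field_simp
      ring

lemma G_le {x : ℝ} (ha : 0 ≤ x) (hb : x ≤ 1/2) : SS x ^ 6 * ∏ j : Fin 6, SS (zfun j x) ≤ 1/2 := by
  have B {a t s : ℝ} (h0 : 0 ≤ a) (h1 : a ≤ t) (h2 : t ≤ 1/2) (h3 : SS t ≤ s) : SS a ≤ s :=
    (SS_mono h0 h1 h2).trans h3
  have P := fun j => (SS_pos (z_mem ha hb j).1 (z_mem ha hb j).2).le
  have M : ∀ j, SS (zfun j x) ≤ 1.2 := fun j =>
    B (z_mem ha hb j).1 (z_mem ha hb j).2 le_rfl (by norm_num [SS])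
  have hx := (SS_pos ha hb).le
  have P0 := P 0
  have P1 := P 1
  have P2 := P 2
  have P3 := P 3
  have P4 := P 4
  have P5 := P 5
  rw [Fin.prod_univ_six]
  rcases le_total x 0.4 with h | h
  · have h0 : SS x ≤ 0.88 := B ha h (by norm_num) (by norm_num [SS])
    have h4 : SS (zfun 4 x) ≤ 0.6 := by
      refine B (t := 1/4) (z_mem ha hb 4).1 ?_ (by norm_num) (by norm_num [SS])
      simp only [zfun, Matrix.cons_val]
      rw [div_le_iff₀ (by linarith)]; linarith
    have h5 : SS (zfun 5 x) ≤ 0.74 := by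
      refine B (t := 1/3) (z_mem ha hb 5).1 ?_ (by norm_num) (by norm_num [SS])
      simp only [zfun, Matrix.cons_val]
      linarith
    calc _ ≤ (0.88:ℝ)^6 * (1.2 * 1.2 * 1.2 * 1.2 * 0.6 * 0.74) := by
          gcongr <;> apply M
      _ ≤ _ := by norm_num
  · have h0 : SS x ≤ 1.2 := B ha hb (by norm_num) (by norm_num [SS])
    have h1 : SS (zfun 1 x) ≤ 0.6 := by
      refine B (t := 1/4) (z_mem ha hb 1).1 ?_ (by norm_num) (by norm_num [SS])
      simp only [zfun, Matrix.cons_val]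
      rw [if_neg (by norm_num at h ⊢; linarith), div_le_iff₀ (by linarith)]
      norm_num at h; linarith
    have h2 : SS (zfun 2 x) ≤ 0.6 := by
      refine B (t := 1/4) (z_mem ha hb 2).1 ?_ (by norm_num) (by norm_num [SS])
      simp only [zfun, Matrix.cons_val]
      rw [if_neg (by norm_num at h ⊢; linarith), div_le_iff₀ (by linarith)]
      norm_num at h; linarith
    have h4 : SS (zfun 4 x) ≤ 0.45 := by
      refine B (t := 1/15) (z_mem ha hb 4).1 ?_ (by norm_num) (by norm_num [SS])
      simp only [zfun, Matrix.cons_val]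
      rw [div_le_iff₀ (by linarith)]; norm_num at h; linarith
    have h5 : SS (zfun 5 x) ≤ 0.45 := by
      refine B (t := 1/15) (z_mem ha hb 5).1 ?_ (by norm_num) (by norm_num [SS])
      simp only [zfun, Matrix.cons_val]
      norm_num at h; linarith
    calc _ ≤ (1.2:ℝ)^6 * (1.2 * 0.6 * 0.6 * 1.2 * 0.45 * 0.45) := by
          gcongr <;> apply M
      _ ≤ _ := by norm_num

/-- **Average contraction of the two-step IFS.** There is `c ∈ (0,1)` such that for all
`x, y ∈ [0,1/2]`, `∏_{i,j} |z_i(z_j(y)) − z_i(z_j(x))| ≤ c³⁶·|y − x|³⁶`: the two-step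
iterated random function system `(z_i ∘ z_j)` contracts in the geometric-mean sense. -/
theorem two_step_geometric_mean_contraction :
    ∃ c : ℝ, 0 < c ∧ c < 1 ∧
      ∀ x ∈ Set.Icc (0:ℝ) (1/2), ∀ y ∈ Set.Icc (0:ℝ) (1/2),
        ∏ i : Fin 6, ∏ j : Fin 6, |zfun i (zfun j y) - zfun i (zfun j x)|
          ≤ c^36 * |y - x|^36 := by
  refine ⟨0.97, by norm_num, by norm_num, ?_⟩
  rintro x ⟨hx, hx'⟩ y ⟨hy, hy'⟩
  have sx := fun j => SS_pos (z_mem hx hx' j).1 (z_mem hx hx' j).2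
  have sy := fun j => SS_pos (z_mem hy hy' j).1 (z_mem hy hy' j).2
  have X0 : 0 ≤ ∏ j, SS (zfun j x) := Finset.prod_nonneg fun j _ => (sx j).le
  have Y0 : 0 ≤ ∏ j, SS (zfun j y) := Finset.prod_nonneg fun j _ => (sy j).le
  have tx := SS_pos hx hx'
  have ty := SS_pos hy hy'
  rw [Finset.prod_comm]
  calc _ ≤ ∏ j : Fin 6, (|zfun j y - zfun j x|^6 * SS (zfun j x) * SS (zfun j y)) := by
        refine Finset.prod_le_prod (fun j _ => Finset.prod_nonneg fun i _ => abs_nonneg _) fun j _ => ?_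
        exact one_step (z_mem hx hx' j).1 (z_mem hx hx' j).2 (z_mem hy hy' j).1 (z_mem hy hy' j).2
    _ = (∏ j : Fin 6, |zfun j y - zfun j x|)^6 * (∏ j, SS (zfun j x)) * ∏ j, SS (zfun j y) := by
        rw [Finset.prod_mul_distrib, Finset.prod_mul_distrib, Finset.prod_pow]
    _ ≤ (|y - x|^6 * SS x * SS y)^6 * (∏ j, SS (zfun j x)) * ∏ j, SS (zfun j y) := by
        have := one_step hx hx' hy hy'
        have h0 : 0 ≤ ∏ j : Fin 6, |zfun j y - zfun j x| :=
          Finset.prod_nonneg fun i _ => abs_nonneg _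
        gcongr
    _ = (SS x ^ 6 * ∏ j, SS (zfun j x)) * (SS y ^ 6 * ∏ j, SS (zfun j y)) * |y-x|^36 := by ring
    _ ≤ (1/2 * (1/2)) * |y-x|^36 := by
        have := G_le hx hx'
        have := G_le hy hy'
        gcongr
    _ ≤ _ := by
        gcongr
        norm_num

end
end

section
/- The kernel M is ergodic: there exists a unique M-invariant probability measure μ on [0,1/2], and for every probability measure ν on [0,1/2], the measures νM^n converge weakly to μ as n → ∞ (in particular M^n(x,·) → μ weakly for every x ∈ [0,1/2]). -/
open MeasureTheory ProbabilityTheory Filter Set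

noncomputable section

/-- The flat-triangle Markov kernel `M`, as an operator on measures:
`ν ↦ (1/6)·∑ i, (z_i)_* ν`; its `n`-th iterate applied to `δ_x` is `M^n(x, ·)`. -/
def Mstep (ν : Measure ℝ) : Measure ℝ :=
  ∑ i : Fin 6, (6 : ENNReal)⁻¹ • ν.map (zfun i)

/-- A measure `μ` is `M`-invariant if `μ(B) = (1/6)·∑ i, μ(z_i⁻¹(B))` for every Borel `B`. -/
def MInvariant (μ : Measure ℝ) : Prop :=
  ∀ B : Set ℝ, MeasurableSet B → μ B = (6 : ENNReal)⁻¹ * ∑ i : Fin 6, μ (zfun i ⁻¹' B)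

def wt (x : ℝ) : ℝ := 1 + x * (1 - x)

def rr : Fin 6 → ℝ → ℝ :=
  ![ fun x => 1/(2*(1+x)), fun x => 1/(2-x), fun x => 1/(3*(1-x)),
     fun x => 1/(2*(2-x)), fun x => 1/(2*(2-x)), fun _ => 1/3 ]

lemma rr_bounds (i : Fin 6) {x : ℝ} (h0 : 0 ≤ x) (h1 : x ≤ 1/2) : 0 ≤ rr i x ∧ rr i x ≤ 1 := by
  fin_cases i <;> simp only [rr, Fin.zero_eta, Fin.mk_one, Fin.reduceFinMk, Matrix.cons_val] <;>
    constructor <;>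
    first
    | (norm_num; done)
    | (apply div_nonneg <;> linarith)
    | (rw [div_le_one (by linarith)]; linarith)

lemma zfun_mem (i : Fin 6) {x : ℝ} (h0 : 0 ≤ x) (h1 : x ≤ 1/2) :
    0 ≤ zfun i x ∧ zfun i x ≤ 1/2 := by
  fin_cases i <;> simp only [zfun, Fin.zero_eta, Fin.mk_one, Fin.reduceFinMk, Matrix.cons_val] <;>
    (try split_ifs) <;>
    constructor <;>
    first
    | (apply div_nonneg <;> linarith)
    | (rw [div_le_iff₀ (by linarith)]; linarith)

lemma fold_abs {u v a b : ℝ} (ha : a = u ∨ a = 1 - u) (hb : b = v ∨ b = 1 - v)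
    (ha' : a ≤ 1/2) (hb' : b ≤ 1/2) : |a - b| ≤ |u - v| := by
  rcases ha with rfl | rfl <;> rcases hb with rfl | rfl
  · exact le_rfl
  · rw [abs_le]; constructor <;> cases abs_cases (a - v) <;> linarith
  · rw [abs_le]; constructor <;> cases abs_cases (u - b) <;> linarith
  · rw [abs_le]; constructor <;> cases abs_cases (u - v) <;> linarith

/-- unfolded maps -/
def uu : Fin 6 → ℝ → ℝ :=
  ![ fun x => 3*x/(2+2*x), fun x => 3*x/(2-x), fun x => (1+x)/(3-3*x),
     fun x => (1+x)/(4-2*x), fun x => (1-2*x)/(4-2*x), fun x => (1-2*x)/3 ]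

lemma zfun_uu (i : Fin 6) {x : ℝ} (h0 : 0 ≤ x) (h1 : x ≤ 1/2) :
    zfun i x = uu i x ∨ zfun i x = 1 - uu i x := by
  fin_cases i <;>
    simp only [zfun, uu, Fin.zero_eta, Fin.mk_one, Fin.reduceFinMk, Matrix.cons_val, true_or]
  · split_ifs
    · left; rfl
    · right
      have : 2 - x ≠ 0 := by linarith
      field_simp; ring
  · split_ifs
    · left; rfl
    · right
      have : 1 - x ≠ 0 := by linarith
      have q5 : 3 - 3 * x = 3 * (1 - x) := by ring
      rw [q5]
      field_simp; ring

lemma uu_diff (i : Fin 6) {x y : ℝ} (h0 : 0 ≤ x) (h1 : x ≤ 1/2) (h0' : 0 ≤ y) (h1' : y ≤ 1/2) :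
    |uu i x - uu i y| = 6 * rr i x * rr i y * |x - y| := by
  have hx := (rr_bounds i h0 h1).1
  have hy := (rr_bounds i h0' h1').1
  have : |uu i x - uu i y| = |6 * rr i x * rr i y * (x - y)| := by
    have e1 : 1 + x ≠ 0 := by linarith
    have e2 : 1 + y ≠ 0 := by linarith
    have e3 : 2 - x ≠ 0 := by linarith
    have e4 : 2 - y ≠ 0 := by linarith
    have e5 : 1 - x ≠ 0 := by linarith
    have e6 : 1 - y ≠ 0 := by linarith
    have q1 : 2 + 2 * x = 2 * (1 + x) := by ring
    have q2 : 2 + 2 * y = 2 * (1 + y) := by ring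
    have q3 : 4 - 2 * x = 2 * (2 - x) := by ring
    have q4 : 4 - 2 * y = 2 * (2 - y) := by ring
    have q5 : 3 - 3 * x = 3 * (1 - x) := by ring
    have q6 : 3 - 3 * y = 3 * (1 - y) := by ring
    rw [abs_eq_abs]
    fin_cases i <;>
    simp only [uu, rr, Fin.zero_eta, Fin.mk_one, Fin.reduceFinMk, Matrix.cons_val,
      q1, q2, q3, q4, q5, q6] <;>
    first
    | (left; field_simp; ring; done)
    | (right; field_simp; ring; done)
  rw [this, abs_mul, abs_of_nonneg (by positivity)]

lemma zfun_diff (i : Fin 6) {x y : ℝ} (h0 : 0 ≤ x) (h1 : x ≤ 1/2) (h0' : 0 ≤ y) (h1' : y ≤ 1/2) :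
    |zfun i x - zfun i y| ≤ 6 * rr i x * rr i y * |x - y| := by
  rw [← uu_diff i h0 h1 h0' h1']
  exact fold_abs (zfun_uu i h0 h1) (zfun_uu i h0' h1') (zfun_mem i h0 h1).2 (zfun_mem i h0' h1').2

lemma wt_zfun (i : Fin 6) {x : ℝ} (h0 : 0 ≤ x) (h1 : x ≤ 1/2) : wt (zfun i x) = wt (uu i x) := by
  rcases zfun_uu i h0 h1 with h | h <;> rw [h]
  unfold wt; ring

lemma wt_ge {x : ℝ} (h0 : 0 ≤ x) (h1 : x ≤ 1/2) : 1 ≤ wt x := by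
  unfold wt; nlinarith

lemma wt_le {x : ℝ} : wt x ≤ 5/4 := by
  unfold wt; nlinarith [sq_nonneg (x - 1/2)]

lemma key {x : ℝ} (h0 : 0 ≤ x) (h1 : x ≤ 1/2) :
    ∑ i, rr i x * wt (zfun i x) ≤ 2.42 * wt x := by
  simp_rw [wt_zfun _ h0 h1]
  rw [Fin.sum_univ_six]
  simp only [rr, uu, wt, Matrix.cons_val]
  have e1 : 0 < 1 + x := by linarith
  have e3 : 0 < 2 - x := by linarith
  have e5 : 0 < 1 - x := by linarith
  have q1 : 2 + 2 * x = 2 * (1 + x) := by ring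
  have q3 : 4 - 2 * x = 2 * (2 - x) := by ring
  have q5 : 3 - 3 * x = 3 * (1 - x) := by ring
  have e7 : 0 ≤ 1 - 2 * x := by linarith
  rw [q1, q3, q5, ← sub_nonneg]
  have : 0 ≤ (494*(1-2*x)^11 + 30246*x^1*(1-2*x)^10 + 448431*x^2*(1-2*x)^9
      + 3079080*x^3*(1-2*x)^8 + 11983743*x^4*(1-2*x)^7 + 29046519*x^5*(1-2*x)^6
      + 46489140*x^6*(1-2*x)^5 + 52024923*x^7*(1-2*x)^4 + 43716672*x^8*(1-2*x)^3
      + 28699272*x^9*(1-2*x)^2 + 13253220*x^10*(1-2*x)^1 + 3018060*x^11)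
      / (5400 * ((1+x)^3*(2-x)^3*(1-x)^3)) := by positivity
  refine this.trans_eq ?_
  field_simp
  ring

/-- The dual operator. -/
def PP (g : ℝ → ℝ) (x : ℝ) : ℝ := (∑ i, g (zfun i x)) / 6

def DD (x y : ℝ) : ℝ := √(|x - y| * (wt x * wt y))

def rho : ℝ := 2.42 / √6

lemma rho_nonneg : 0 ≤ rho := by unfold rho; positivity

lemma rho_lt : rho < 1 := by
  unfold rho
  rw [div_lt_one (by positivity)]
  exact Real.lt_sqrt_of_sq_lt (by norm_num)

lemma DD_contract {x y : ℝ} (h0 : 0 ≤ x) (h1 : x ≤ 1/2) (h0' : 0 ≤ y) (h1' : y ≤ 1/2) :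
    (∑ i, DD (zfun i x) (zfun i y)) / 6 ≤ rho * DD x y := by
  have hw : ∀ {x : ℝ}, 0 ≤ x → x ≤ 1/2 → 0 ≤ wt x := fun a b => zero_le_one.trans (wt_ge a b)
  have A : ∀ i, DD (zfun i x) (zfun i y) ≤
      √(6 * |x - y|) * (√(rr i x * wt (zfun i x)) * √(rr i y * wt (zfun i y))) := by
    intro i
    have m1 := zfun_mem i h0 h1
    have m2 := zfun_mem i h0' h1'
    have w1 := hw m1.1 m1.2
    have w2 := hw m2.1 m2.2
    have r1 := (rr_bounds i h0 h1).1
    have r2 := (rr_bounds i h0' h1').1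
    rw [← Real.sqrt_mul (by positivity), ← Real.sqrt_mul (by positivity)]
    apply Real.sqrt_le_sqrt
    calc _ ≤ (6 * rr i x * rr i y * |x - y|) * (wt (zfun i x) * wt (zfun i y)) :=
          mul_le_mul_of_nonneg_right (zfun_diff i h0 h1 h0' h1') (by positivity)
      _ = _ := by ring
  have nn : ∀ {x : ℝ}, 0 ≤ x → x ≤ 1/2 → ∀ i, 0 ≤ rr i x * wt (zfun i x) := fun a b i =>
    mul_nonneg (rr_bounds i a b).1 (hw (zfun_mem i a b).1 (zfun_mem i a b).2)
  have B : ∑ i, DD (zfun i x) (zfun i y) ≤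
      √(6 * |x - y|) * (√(2.42 * wt x) * √(2.42 * wt y)) := by
    refine (Finset.sum_le_sum fun i _ => A i).trans ?_
    rw [← Finset.mul_sum]
    refine mul_le_mul_of_nonneg_left ?_ (Real.sqrt_nonneg _)
    refine (Real.sum_sqrt_mul_sqrt_le _ (nn h0 h1) (nn h0' h1')).trans ?_
    exact mul_le_mul (Real.sqrt_le_sqrt (key h0 h1)) (Real.sqrt_le_sqrt (key h0' h1'))
      (Real.sqrt_nonneg _) (Real.sqrt_nonneg _)
  have C : √(6 * |x - y|) * (√(2.42 * wt x) * √(2.42 * wt y)) = 6 * (rho * DD x y) := by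
    have w1 := hw h0 h1
    have w2 := hw h0' h1'
    have s6 : √6 * √6 = (6:ℝ) := Real.mul_self_sqrt (by norm_num)
    have s6' : √(6:ℝ) ≠ 0 := by positivity
    have s2 : √(2.42:ℝ) * √2.42 = 2.42 := Real.mul_self_sqrt (by norm_num)
    unfold rho DD
    rw [Real.sqrt_mul (by norm_num), Real.sqrt_mul (by norm_num), Real.sqrt_mul (by norm_num),
      Real.sqrt_mul (by positivity), Real.sqrt_mul w1]
    have : (6:ℝ) * (2.42 / √6 * (√|x - y| * (√(wt x) * √(wt y)))) =
      √6 * 2.42 * (√|x - y| * (√(wt x) * √(wt y))) := by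
      have : (6:ℝ) * (2.42 / √6) = √6 * 2.42 := by
        rw [← mul_div_assoc, div_eq_iff s6']; linear_combination (-2.42) * s6
      rw [← this]; ring
    rw [this]
    linear_combination (√6 * (√|x - y| * (√(wt x) * √(wt y)))) * s2
  rw [div_le_iff₀ (by norm_num)]
  linarith

lemma DD_le_one {x y : ℝ} (h0 : 0 ≤ x) (h1 : x ≤ 1/2) (h0' : 0 ≤ y) (h1' : y ≤ 1/2) :
    DD x y ≤ 1 := by
  unfold DD
  rw [Real.sqrt_le_one]
  have : |x - y| ≤ 1/2 := by rw [abs_le]; constructor <;> linarith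
  have a := wt_ge h0 h1
  have b := wt_ge h0' h1'
  have c := wt_le (x := x)
  have d := wt_le (x := y)
  have : wt x * wt y ≤ 5/4 * (5/4) := mul_le_mul c d (by linarith) (by norm_num)
  calc _ ≤ 1/2 * (5/4 * (5/4) : ℝ) := mul_le_mul ‹_› this (by positivity) (by norm_num)
    _ ≤ 1 := by norm_num

lemma abs_le_DD {x y : ℝ} (h0 : 0 ≤ x) (h1 : x ≤ 1/2) (h0' : 0 ≤ y) (h1' : y ≤ 1/2) :
    |x - y| ≤ DD x y := by
  unfold DD
  apply Real.le_sqrt_of_sq_le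
  have : |x - y| ≤ 1 := by rw [abs_le]; constructor <;> linarith
  have h : 1 ≤ wt x * wt y := one_le_mul_of_one_le_of_one_le (wt_ge h0 h1) (wt_ge h0' h1')
  have := abs_nonneg (x - y)
  nlinarith

lemma PP_contract {g : ℝ → ℝ} {K : ℝ} (hK : 0 ≤ K)
    (hg : ∀ x ∈ Icc (0:ℝ) (1/2), ∀ y ∈ Icc (0:ℝ) (1/2), |g x - g y| ≤ K * DD x y) :
    ∀ x ∈ Icc (0:ℝ) (1/2), ∀ y ∈ Icc (0:ℝ) (1/2), |PP g x - PP g y| ≤ (K * rho) * DD x y := by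
  rintro x ⟨h0, h1⟩ y ⟨h0', h1'⟩
  unfold PP
  rw [← sub_div, ← Finset.sum_sub_distrib, abs_div, abs_of_pos (by norm_num : (0:ℝ) < 6)]
  have := DD_contract h0 h1 h0' h1'
  calc _ ≤ (∑ i, K * DD (zfun i x) (zfun i y)) / 6 := by
        gcongr
        refine (Finset.abs_sum_le_sum_abs _ _).trans (Finset.sum_le_sum fun i _ => ?_)
        exact hg _ (zfun_mem i h0 h1) _ (zfun_mem i h0' h1')
    _ = K * ((∑ i, DD (zfun i x) (zfun i y)) / 6) := by rw [← Finset.mul_sum]; ring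
    _ ≤ K * (rho * DD x y) := by gcongr
    _ = _ := by ring

lemma PP_iter {g : ℝ → ℝ} {K : ℝ} (hK : 0 ≤ K)
    (hg : ∀ x ∈ Icc (0:ℝ) (1/2), ∀ y ∈ Icc (0:ℝ) (1/2), |g x - g y| ≤ K * DD x y) (n : ℕ) :
    ∀ x ∈ Icc (0:ℝ) (1/2), ∀ y ∈ Icc (0:ℝ) (1/2),
      |(PP^[n] g) x - (PP^[n] g) y| ≤ (K * rho ^ n) * DD x y := by
  induction n with
  | zero => simpa using hg
  | succ n ih =>
    rw [Function.iterate_succ_apply', pow_succ, ← mul_assoc]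
    exact PP_contract (mul_nonneg hK (pow_nonneg rho_nonneg n)) ih

lemma zfun_meas (i : Fin 6) : Measurable (zfun i) := by
  fin_cases i <;> simp only [zfun, Fin.zero_eta, Fin.mk_one, Fin.reduceFinMk, Matrix.cons_val]
  · fun_prop
  · exact Measurable.ite measurableSet_Iio (by fun_prop) (by fun_prop)
  · exact Measurable.ite measurableSet_Iio (by fun_prop) (by fun_prop)
  · fun_prop
  · fun_prop
  · fun_prop

lemma Mstep_apply (ν : Measure ℝ) {B : Set ℝ} (hB : MeasurableSet B) :
    Mstep ν B = (6 : ENNReal)⁻¹ * ∑ i : Fin 6, ν (zfun i ⁻¹' B) := by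
  simp [Mstep, Measure.map_apply (zfun_meas _) hB, Finset.mul_sum]

lemma MInvariant_iff (μ : Measure ℝ) : MInvariant μ ↔ Mstep μ = μ := by
  constructor
  · intro h
    ext B hB
    rw [Mstep_apply _ hB, h B hB]
  · intro h B hB
    rw [← Mstep_apply _ hB, h]

lemma Mstep_prob (ν : Measure ℝ) [IsProbabilityMeasure ν] : IsProbabilityMeasure (Mstep ν) := by
  constructor
  rw [Mstep_apply _ MeasurableSet.univ]
  simp [ENNReal.inv_mul_cancel]

lemma Mstep_supp (ν : Measure ℝ) [IsProbabilityMeasure ν] (h : ν (Icc (0:ℝ) (1/2)) = 1) :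
    Mstep ν (Icc (0:ℝ) (1/2)) = 1 := by
  rw [Mstep_apply _ measurableSet_Icc]
  have : ∀ i, ν (zfun i ⁻¹' Icc (0:ℝ) (1/2)) = 1 := fun i =>
    le_antisymm prob_le_one (h ▸ measure_mono fun x hx => zfun_mem i hx.1 hx.2)
  simp only [this]
  simp [ENNReal.inv_mul_cancel]

lemma iter_prob (ν : Measure ℝ) [IsProbabilityMeasure ν] (h : ν (Icc (0:ℝ) (1/2)) = 1) (n : ℕ) :
    IsProbabilityMeasure (Mstep^[n] ν) ∧ (Mstep^[n] ν) (Icc (0:ℝ) (1/2)) = 1 := by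
  induction n with
  | zero => exact ⟨‹_›, h⟩
  | succ n ih =>
    rw [Function.iterate_succ_apply']
    have := ih.1
    exact ⟨Mstep_prob _, Mstep_supp _ ih.2⟩

lemma bdd_int {ν : Measure ℝ} [IsFiniteMeasure ν] {g : ℝ → ℝ} (hm : Measurable g) {C : ℝ}
    (hC : ∀ x, |g x| ≤ C) : Integrable g ν :=
  Integrable.of_bound hm.aestronglyMeasurable C (Eventually.of_forall hC)

lemma PP_meas {g : ℝ → ℝ} (hm : Measurable g) : Measurable (PP g) :=
  (Finset.measurable_sum _ fun i _ => hm.comp (zfun_meas i)).div_const 6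

lemma PP_bdd {g : ℝ → ℝ} {C : ℝ} (hC : ∀ x, |g x| ≤ C) (x : ℝ) : |PP g x| ≤ C := by
  unfold PP
  rw [abs_div, abs_of_pos (by norm_num : (0:ℝ) < 6), div_le_iff₀ (by norm_num)]
  refine (Finset.abs_sum_le_sum_abs _ _).trans ((Finset.sum_le_sum fun i _ => hC _).trans ?_)
  simp; linarith

lemma int_Mstep {ν : Measure ℝ} [IsProbabilityMeasure ν] {g : ℝ → ℝ} (hm : Measurable g) {C : ℝ}
    (hC : ∀ x, |g x| ≤ C) : ∫ x, g x ∂(Mstep ν) = ∫ x, PP g x ∂ν := by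
  unfold Mstep PP
  have hp : ∀ i, IsProbabilityMeasure (ν.map (zfun i)) := fun i =>
    Measure.isProbabilityMeasure_map (zfun_meas i).aemeasurable
  rw [integral_finset_sum_measure]
  · rw [integral_div, integral_finset_sum]
    · rw [Finset.sum_div]
      refine Finset.sum_congr rfl fun i _ => ?_
      rw [integral_smul_measure, integral_map (zfun_meas i).aemeasurable
        hm.aestronglyMeasurable]
      simp; ring
    · intro i _
      exact bdd_int (hm.comp (zfun_meas i)) fun x => hC _
  · intro i _
    exact (bdd_int hm hC).smul_measure (by simp)

lemma int_iter {ν : Measure ℝ} [IsProbabilityMeasure ν] (h : ν (Icc (0:ℝ) (1/2)) = 1)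
    {C : ℝ} (n : ℕ) : ∀ {g : ℝ → ℝ}, Measurable g → (∀ x, |g x| ≤ C) → 
    (∫ x, g x ∂(Mstep^[n] ν) = ∫ x, (PP^[n] g) x ∂ν ∧ Measurable (PP^[n] g) ∧
      ∀ x, |(PP^[n] g) x| ≤ C) := by
  induction n with
  | zero => intro g hm hC; exact ⟨rfl, hm, hC⟩
  | succ n ih =>
    intro g hm hC
    rw [Function.iterate_succ_apply', Function.iterate_succ_apply]
    have := (iter_prob ν h n).1
    rw [int_Mstep hm hC]
    exact ih (PP_meas hm) (PP_bdd hC)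

lemma int_close {ν : Measure ℝ} [IsProbabilityMeasure ν] (h : ν (Icc (0:ℝ) (1/2)) = 1)
    {f : ℝ → ℝ} (hm : Measurable f) {C : ℝ} (hC : ∀ x, |f x| ≤ C) {ε : ℝ}
    (hf : ∀ x ∈ Icc (0:ℝ) (1/2), |f x - f 0| ≤ ε) : |∫ x, f x ∂ν - f 0| ≤ ε := by
  have hae : ∀ᵐ x ∂ν, x ∈ Icc (0:ℝ) (1/2) := by
    rwa [← prob_compl_eq_zero_iff measurableSet_Icc] at h
  have : ∫ x, f x ∂ν - f 0 = ∫ x, (f x - f 0) ∂ν := by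
    rw [integral_sub (bdd_int hm hC) (integrable_const _)]; simp
  rw [this]
  have := norm_integral_le_of_norm_le_const (μ := ν) (f := fun x => f x - f 0) (C := ε)
    (hae.mono fun x hx => hf x hx)
  simpa using this

lemma conv {ν ν' : Measure ℝ} [IsProbabilityMeasure ν] [IsProbabilityMeasure ν']
    (h : ν (Icc (0:ℝ) (1/2)) = 1) (h' : ν' (Icc (0:ℝ) (1/2)) = 1)
    {g : ℝ → ℝ} {C : ℝ} (hC : ∀ x, |g x| ≤ C) {L : NNReal} (hL : LipschitzWith L g) :
    Tendsto (fun n => ∫ x, g x ∂(Mstep^[n] ν) - ∫ x, g x ∂(Mstep^[n] ν')) atTop (nhds 0) := by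
  have hm : Measurable g := hL.continuous.measurable
  have hg : ∀ x ∈ Icc (0:ℝ) (1/2), ∀ y ∈ Icc (0:ℝ) (1/2), |g x - g y| ≤ (L:ℝ) * DD x y := by
    intro x hx y hy
    have := hL.dist_le_mul x y
    rw [Real.dist_eq, Real.dist_eq] at this
    exact this.trans (mul_le_mul_of_nonneg_left (abs_le_DD hx.1 hx.2 hy.1 hy.2) L.2)
  have lim : Tendsto (fun n => 2 * ((L:ℝ) * rho ^ n)) atTop (nhds 0) := by
    have := ((tendsto_pow_atTop_nhds_zero_of_lt_one rho_nonneg rho_lt).const_mul (L:ℝ)).const_mul 2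
    simpa using this
  refine squeeze_zero_norm (fun n => ?_) lim
  have z0 : (0:ℝ) ∈ Icc (0:ℝ) (1/2) := by constructor <;> norm_num
  have hf : ∀ x ∈ Icc (0:ℝ) (1/2), |(PP^[n] g) x - (PP^[n] g) 0| ≤ (L:ℝ) * rho ^ n := by
    intro x hx
    refine (PP_iter L.2 hg n x hx 0 z0).trans ?_
    exact mul_le_of_le_one_right (mul_nonneg L.2 (pow_nonneg rho_nonneg n))
      (DD_le_one hx.1 hx.2 z0.1 z0.2)
  obtain ⟨a1, a2, a3⟩ := int_iter h n hm hC
  obtain ⟨b1, -, -⟩ := int_iter h' n hm hC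
  have c1 := int_close h a2 a3 hf
  have c2 := int_close h' a2 a3 hf
  rw [a1, b1, Real.norm_eq_abs, abs_le]
  rw [abs_le] at c1 c2
  constructor <;> linarith

lemma bdd_of {g : ℝ → ℝ} (h : ∃ C : ℝ, ∀ x y, dist (g x) (g y) ≤ C) : ∃ C : ℝ, ∀ x, |g x| ≤ C := by
  obtain ⟨C, hC⟩ := h
  refine ⟨C + |g 0|, fun x => ?_⟩
  have := hC x 0
  rw [Real.dist_eq] at this
  have h2 := abs_sub_abs_le_abs_sub (g x) (g 0)
  linarith

lemma ext_lip {μ μ' : Measure ℝ} [h : IsProbabilityMeasure μ] [h' : IsProbabilityMeasure μ']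
    (H : ∀ (g : ℝ → ℝ) (C : ℝ), (∀ x, |g x| ≤ C) → ∀ L, LipschitzWith L g →
      ∫ x, g x ∂μ = ∫ x, g x ∂μ') : μ = μ' := by
  let m : ProbabilityMeasure ℝ := ⟨μ, h⟩
  let m' : ProbabilityMeasure ℝ := ⟨μ', h'⟩
  have : Tendsto (fun _ : ℕ => m) atTop (nhds m') := by
    rw [tendsto_iff_forall_lipschitz_integral_tendsto]
    rintro f hb ⟨L, hL⟩
    obtain ⟨C, hC⟩ := bdd_of hb
    have := H f C hC L hL
    change Tendsto (fun _ : ℕ => ∫ x, f x ∂μ) atTop (nhds (∫ x, f x ∂μ'))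
    rw [this]
    exact tendsto_const_nhds
  have e : m = m' := tendsto_nhds_unique tendsto_const_nhds this
  exact congrArg (fun q : ProbabilityMeasure ℝ => (q : Measure ℝ)) e

lemma zfun_cont (i : Fin 6) : Continuous fun x : ℝ => zfun i (max 0 (min x (1/2))) := by
  have hc : ContinuousOn (zfun i) (Icc (0:ℝ) (1/2)) := by
    have : LipschitzOnWith 6 (zfun i) (Icc (0:ℝ) (1/2)) := by
      apply LipschitzOnWith.of_dist_le_mul
      rintro x ⟨h0, h1⟩ y ⟨h0', h1'⟩
      rw [Real.dist_eq, Real.dist_eq]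
      refine (zfun_diff i h0 h1 h0' h1').trans ?_
      have a := rr_bounds i h0 h1
      have b := rr_bounds i h0' h1'
      have : rr i x * rr i y ≤ 1 := mul_le_one₀ a.2 b.1 b.2
      push_cast
      refine mul_le_mul_of_nonneg_right ?_ (abs_nonneg _)
      linarith
    exact this.continuousOn
  refine hc.comp_continuous (by fun_prop) fun x => ⟨le_max_left _ _, ?_⟩
  exact max_le (by norm_num) (min_le_right _ _)

lemma pj_eq {x : ℝ} (hx : x ∈ Icc (0:ℝ) (1/2)) : max 0 (min x (1/2)) = x := by
  rw [min_eq_left hx.2, max_eq_right hx.1]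

lemma ae_mem {ν : Measure ℝ} [IsProbabilityMeasure ν] (h : ν (Icc (0:ℝ) (1/2)) = 1) :
    ∀ᵐ x ∂ν, x ∈ Icc (0:ℝ) (1/2) := by
  rwa [← prob_compl_eq_zero_iff measurableSet_Icc] at h

lemma exists_inv : ∃ μ : Measure ℝ, IsProbabilityMeasure μ ∧ μ (Icc (0:ℝ) (1/2)) = 1 ∧
    Mstep μ = μ := by
  have d1 : (Measure.dirac (0:ℝ)) (Icc (0:ℝ) (1/2)) = 1 := by
    rw [Measure.dirac_apply' _ measurableSet_Icc]; simp
  set δ : Measure ℝ := Measure.dirac (0:ℝ) with hδ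
  let u : ℕ → ProbabilityMeasure ℝ := fun n => ⟨Mstep^[n] δ, (iter_prob δ d1 n).1⟩
  have hu : ∀ n, (u n : Measure ℝ) (Icc (0:ℝ) (1/2)) = 1 := fun n => (iter_prob δ d1 n).2
  have hcomp : IsCompact (closure (range u)) := by
    apply isCompact_closure_of_isTightMeasureSet
    rw [isTightMeasureSet_iff_exists_isCompact_measure_compl_le]
    intro ε _
    refine ⟨Icc (0:ℝ) (1/2), isCompact_Icc, ?_⟩
    rintro _ ⟨_, ⟨n, rfl⟩, rfl⟩
    rw [(prob_compl_eq_zero_iff measurableSet_Icc).2 (hu n)]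
    exact zero_le
  obtain ⟨μ, -, hμ⟩ := hcomp.ultrafilter_le_nhds ((hyperfilter ℕ).map u) (by
    rw [le_principal_iff]
    exact Filter.mem_map.2 (Filter.univ_mem' fun n => subset_closure (mem_range_self n)))
  have hμ' : Tendsto u (hyperfilter ℕ : Filter ℕ) (nhds μ) := hμ
  rw [ProbabilityMeasure.tendsto_iff_forall_integral_tendsto] at hμ'
  have T : ∀ (f : ℝ → ℝ) (C : ℝ), Continuous f → (∀ x, |f x| ≤ C) →
      Tendsto (fun n => ∫ x, f x ∂(Mstep^[n] δ)) (hyperfilter ℕ : Filter ℕ)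
        (nhds (∫ x, f x ∂(μ : Measure ℝ))) := fun f C hf hC =>
    hμ' (BoundedContinuousFunction.ofNormedAddCommGroup f hf C hC)
  have hsupp : (μ : Measure ℝ) (Icc (0:ℝ) (1/2)) = 1 := by
    let f : ℝ → ℝ := fun x => min 1 |x - max 0 (min x (1/2))|
    have fc : Continuous f := by fun_prop
    have f0 : ∀ x, 0 ≤ f x := fun x => le_min zero_le_one (abs_nonneg _)
    have fb : ∀ x, |f x| ≤ 1 := fun x => by rw [abs_of_nonneg (f0 x)]; exact min_le_left _ _
    have t := T f 1 fc fb
    have : ∀ n, ∫ x, f x ∂(Mstep^[n] δ) = 0 := by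
      intro n
      have := (iter_prob δ d1 n).1
      apply integral_eq_zero_of_ae
      filter_upwards [ae_mem (iter_prob δ d1 n).2] with x hx
      simp only [f, pj_eq hx]
      simp
    simp only [this] at t
    have e := tendsto_nhds_unique t tendsto_const_nhds
    rw [integral_eq_zero_iff_of_nonneg f0 (bdd_int fc.measurable fb)] at e
    rw [← prob_compl_eq_zero_iff measurableSet_Icc]
    have : ∀ᵐ x ∂(μ : Measure ℝ), x ∈ Icc (0:ℝ) (1/2) := by
      filter_upwards [e] with x hx
      have h2 : |x - max 0 (min x (1/2))| = 0 := by
        rcases min_choice 1 |x - max 0 (min x (1/2))| with h | h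
        · have : (1:ℝ) = 0 := h.symm.trans hx
          norm_num at this
        · exact h.symm.trans hx
      have h3 : x = max 0 (min x (1/2)) := by linarith [abs_eq_zero.1 h2]
      rw [h3]
      exact ⟨le_max_left _ _, max_le (by norm_num) (min_le_right _ _)⟩
    exact this
  have := Mstep_prob (μ : Measure ℝ)
  refine ⟨μ, inferInstance, hsupp, ?_⟩
  apply ext_lip
  intro g C hC L hL
  rw [int_Mstep hL.continuous.measurable hC]
  let f : ℝ → ℝ := fun x => PP g (max 0 (min x (1/2)))
  have fc : Continuous f := by
    refine Continuous.div_const (continuous_finset_sum _ fun i _ => ?_) 6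
    exact hL.continuous.comp (zfun_cont i)
  have fe : ∀ ν : Measure ℝ, IsProbabilityMeasure ν → ν (Icc (0:ℝ) (1/2)) = 1 →
      ∫ x, PP g x ∂ν = ∫ x, f x ∂ν := by
    intro ν _ hν
    apply integral_congr_ae
    filter_upwards [ae_mem hν] with x hx
    simp only [f, pj_eq hx]
  rw [fe _ inferInstance hsupp]
  have t1 := T f C fc (fun x => PP_bdd hC _)
  have t2 := T g C hL.continuous hC
  have e1 : ∀ n, ∫ x, f x ∂(Mstep^[n] δ) = ∫ x, g x ∂(Mstep^[n] (Mstep δ)) := by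
    intro n
    have := (iter_prob δ d1 n).1
    rw [← fe _ this (iter_prob δ d1 n).2, ← int_Mstep hL.continuous.measurable hC,
      ← Function.iterate_succ_apply' Mstep, Function.iterate_succ_apply]
  simp only [e1] at t1
  have := Mstep_prob δ
  have t3 := (conv (Mstep_supp δ d1) d1 hC hL).mono_left
    (Nat.hyperfilter_le_atTop)
  have := tendsto_nhds_unique (t1.sub t2) t3
  linarith

/-- **Ergodicity of the flat kernel `M`.** There is a unique `M`-invariant probability
measure `μ` on `[0,1/2]`, and for every probability measure `ν` on `[0,1/2]` the laws
`νM^n` converge weakly to `μ`. -/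
theorem M_ergodic :
    ∃ μ : Measure ℝ, IsProbabilityMeasure μ ∧ μ (Set.Icc (0:ℝ) (1/2)) = 1 ∧
      MInvariant μ ∧
      (∀ μ' : Measure ℝ, IsProbabilityMeasure μ' → μ' (Set.Icc (0:ℝ) (1/2)) = 1 →
        MInvariant μ' → μ' = μ) ∧
      (∀ ν : Measure ℝ, IsProbabilityMeasure ν → ν (Set.Icc (0:ℝ) (1/2)) = 1 →
        ∀ g : BoundedContinuousFunction ℝ ℝ,
          Tendsto (fun n : ℕ => ∫ x, g x ∂(Mstep^[n] ν)) atTop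
            (nhds (∫ x, g x ∂μ))) := by
  obtain ⟨μ, hp, hs, hi⟩ := exists_inv
  have hit : ∀ μ' : Measure ℝ, Mstep μ' = μ' → ∀ n, Mstep^[n] μ' = μ' := fun μ' h n =>
    Function.iterate_fixed h n
  refine ⟨μ, hp, hs, (MInvariant_iff μ).2 hi, ?_, ?_⟩
  · intro μ' hp' hs' hi'
    rw [MInvariant_iff] at hi'
    apply ext_lip
    intro g C hC L hL
    have t := conv hs' hs hC hL
    simp only [hit μ hi, hit μ' hi'] at t
    have := tendsto_nhds_unique t tendsto_const_nhds
    linarith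
  · intro ν hν hνs g
    let m : ProbabilityMeasure ℝ := ⟨μ, hp⟩
    let u : ℕ → ProbabilityMeasure ℝ := fun n => ⟨Mstep^[n] ν, (iter_prob ν hνs n).1⟩
    have : Tendsto u atTop (nhds m) := by
      rw [tendsto_iff_forall_lipschitz_integral_tendsto]
      rintro f hb ⟨L, hL⟩
      obtain ⟨C, hC⟩ := bdd_of hb
      have t := conv hνs hs hC hL
      simp only [hit μ hi] at t
      have t2 := t.add_const (∫ x, f x ∂μ)
      simp only [sub_add_cancel, zero_add] at t2
      exact t2
    rw [ProbabilityMeasure.tendsto_iff_forall_integral_tendsto] at this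
    exact this g

end
end

section
/- Every M-invariant probability measure μ on [0,1/2] contains no atom: μ({x}) = 0 for every x ∈ [0,1/2]; in particular μ({0}) = 0. -/
open MeasureTheory ProbabilityTheory Filter Set

noncomputable section

lemma aux_pre (μ : Measure ℝ) [IsProbabilityMeasure μ]
    (hμI : μ (Set.Icc (0:ℝ) (1/2)) = 1) (s : Set ℝ) (t : Finset ℝ)
    (h : ∀ y ∈ s, 0 ≤ y → y ≤ 1/2 → y ∈ t) : μ.real s ≤ ∑ y ∈ t, μ.real {y} := by
  have h0 : μ.real (Set.Icc (0:ℝ) (1/2))ᶜ = 0 := by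
    rw [measureReal_compl measurableSet_Icc]
    simp only [Measure.real, hμI]
    simp
  have h1 : s ⊆ (t : Set ℝ) ∪ (Set.Icc (0:ℝ) (1/2))ᶜ := by
    intro y hy
    by_cases hc : y ∈ Set.Icc (0:ℝ) (1/2)
    · exact Or.inl (h y hy hc.1 hc.2)
    · exact Or.inr hc
  calc μ.real s ≤ μ.real ((t : Set ℝ) ∪ (Set.Icc (0:ℝ) (1/2))ᶜ) := measureReal_mono h1
    _ ≤ μ.real (t : Set ℝ) + μ.real (Set.Icc (0:ℝ) (1/2))ᶜ := measureReal_union_le _ _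
    _ = μ.real (t : Set ℝ) := by rw [h0, add_zero]
    _ = ∑ y ∈ t, μ.real {y} := by rw [sum_measureReal_singleton]

lemma aux_pre0 (μ : Measure ℝ) [IsProbabilityMeasure μ]
    (hμI : μ (Set.Icc (0:ℝ) (1/2)) = 1) (s : Set ℝ)
    (h : ∀ y ∈ s, 0 ≤ y → y ≤ 1/2 → False) : μ.real s ≤ 0 := by
  simpa using aux_pre μ hμI s ∅ (fun y a b c => (h y a b c).elim)

lemma aux_pre1 (μ : Measure ℝ) [IsProbabilityMeasure μ]
    (hμI : μ (Set.Icc (0:ℝ) (1/2)) = 1) (s : Set ℝ) (a : ℝ)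
    (h : ∀ y ∈ s, 0 ≤ y → y ≤ 1/2 → y = a) : μ.real s ≤ μ.real {a} := by
  simpa using aux_pre μ hμI s {a} (fun y p b c => by simpa using (h y p b c))

lemma aux_pre2 (μ : Measure ℝ) [IsProbabilityMeasure μ]
    (hμI : μ (Set.Icc (0:ℝ) (1/2)) = 1) (s : Set ℝ) (a b : ℝ)
    (h : ∀ y ∈ s, 0 ≤ y → y ≤ 1/2 → y = a ∨ y = b) :
    μ.real s ≤ μ.real {a} + μ.real {b} := by
  have := aux_pre μ hμI s {a, b} (fun y p b c => by simpa using (h y p b c))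
  refine this.trans ?_
  by_cases hab : a = b
  · subst hab; simp
  · rw [Finset.sum_pair hab]

lemma pz1 {x y : ℝ} (h0 : 0 ≤ y) (h1 : y ≤ 1/2) (hx0 : 0 ≤ x) (hx1 : x ≤ 1/2)
    (h : zfun 0 y = x) : y = 2*x/(3-2*x) := by
  simp only [zfun, Matrix.cons_val] at h
  rw [div_eq_iff (by linarith)] at h
  rw [eq_div_iff (by linarith)]; linarith

lemma pz2 {x y : ℝ} (h0 : 0 ≤ y) (h1 : y ≤ 1/2) (hx0 : 0 ≤ x) (hx1 : x ≤ 1/2)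
    (h : zfun 1 y = x) : (y = 2*x/(3+x) ∧ y < 2/7) ∨ (y = (2-2*x)/(4-x) ∧ 2/7 ≤ y) := by
  simp only [zfun, Matrix.cons_val] at h
  split_ifs at h with hc
  · left
    rw [div_eq_iff (by linarith)] at h
    rw [eq_div_iff (by linarith)]
    exact ⟨by linarith, hc⟩
  · right
    rw [div_eq_iff (by linarith)] at h
    rw [eq_div_iff (by linarith)]
    exact ⟨by linarith, not_lt.1 hc⟩

lemma pz3 {x y : ℝ} (h0 : 0 ≤ y) (h1 : y ≤ 1/2) (hx0 : 0 ≤ x) (hx1 : x ≤ 1/2)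
    (h : zfun 2 y = x) : (y = (3*x-1)/(1+3*x) ∧ y < 1/5 ∧ 1/3 ≤ x) ∨
      (y = (2-3*x)/(4-3*x) ∧ 1/5 ≤ y) := by
  simp only [zfun, Matrix.cons_val] at h
  split_ifs at h with hc
  · left
    rw [div_eq_iff (by linarith)] at h
    rw [eq_div_iff (by linarith)]
    exact ⟨by linarith, hc, by nlinarith⟩
  · right
    rw [div_eq_iff (by linarith)] at h
    rw [eq_div_iff (by linarith)]
    exact ⟨by linarith, not_lt.1 hc⟩

lemma pz4 {x y : ℝ} (h0 : 0 ≤ y) (h1 : y ≤ 1/2) (hx0 : 0 ≤ x) (hx1 : x ≤ 1/2)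
    (h : zfun 3 y = x) : y = (4*x-1)/(1+2*x) ∧ 1/4 ≤ x := by
  simp only [zfun, Matrix.cons_val] at h
  rw [div_eq_iff (by linarith)] at h
  rw [eq_div_iff (by linarith)]
  exact ⟨by linarith, by nlinarith⟩

lemma pz5 {x y : ℝ} (h0 : 0 ≤ y) (h1 : y ≤ 1/2) (hx0 : 0 ≤ x) (hx1 : x ≤ 1/2)
    (h : zfun 4 y = x) : y = (1-4*x)/(2-2*x) ∧ x ≤ 1/4 := by
  simp only [zfun, Matrix.cons_val] at h
  rw [div_eq_iff (by linarith)] at h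
  rw [eq_div_iff (by linarith)]
  exact ⟨by linarith, by nlinarith⟩

lemma pz6 {x y : ℝ} (h0 : 0 ≤ y) (h1 : y ≤ 1/2) (hx0 : 0 ≤ x) (hx1 : x ≤ 1/2)
    (h : zfun 5 y = x) : y = (1-3*x)/2 ∧ x ≤ 1/3 := by
  simp only [zfun, Matrix.cons_val] at h
  rw [div_eq_iff (by norm_num)] at h
  exact ⟨by linarith, by linarith⟩

lemma inv_real (μ : Measure ℝ) [IsProbabilityMeasure μ] (hinv : MInvariant μ) (x : ℝ) :
    6 * μ.real {x} = μ.real (zfun 0 ⁻¹' {x}) + μ.real (zfun 1 ⁻¹' {x}) + μ.real (zfun 2 ⁻¹' {x})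
      + μ.real (zfun 3 ⁻¹' {x}) + μ.real (zfun 4 ⁻¹' {x}) + μ.real (zfun 5 ⁻¹' {x}) := by
  have h := hinv {x} (measurableSet_singleton x)
  have h2 := congrArg ENNReal.toReal h
  rw [ENNReal.toReal_mul, ENNReal.toReal_sum (fun i _ => measure_ne_top _ _)] at h2
  simp only [Fin.sum_univ_six] at h2
  simp only [Measure.real]
  rw [h2]
  simp

lemma step (μ : Measure ℝ) [IsProbabilityMeasure μ]
    (hμI : μ (Set.Icc (0:ℝ) (1/2)) = 1) (hinv : MInvariant μ) (m : ℝ) (hm : 0 < m)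
    (hmax : ∀ y, μ.real {y} ≤ m) (x : ℝ) (hx : μ.real {x} = m) :
    2*x/(3-2*x) < x ∧ μ.real {2*x/(3-2*x)} = m := by
  have hx01 : 0 ≤ x ∧ x ≤ 1/2 := by
    by_contra hc
    have := aux_pre0 μ hμI {x} (by rintro y rfl a b; exact hc ⟨a, b⟩)
    linarith
  obtain ⟨hx0, hx1⟩ := hx01
  -- mass of 1/2
  have hhalf : 4 * μ.real {(1/2:ℝ)} ≤ μ.real {(2/7:ℝ)} + μ.real {(1/5:ℝ)} := by
    have e := inv_real μ hinv (1/2)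
    have e1 := aux_pre1 μ hμI (zfun 0 ⁻¹' {1/2}) (1/2) (fun y hy a b => by
      have := pz1 a b (by norm_num) (by norm_num) hy; norm_num at this; linarith)
    have e2 := aux_pre1 μ hμI (zfun 1 ⁻¹' {1/2}) (2/7) (fun y hy a b => by
      have := pz2 a b (by norm_num) (by norm_num) hy; norm_num at this
      rcases this with h | h <;> linarith)
    have e3 := aux_pre1 μ hμI (zfun 2 ⁻¹' {1/2}) (1/5) (fun y hy a b => by
      have := pz3 a b (by norm_num) (by norm_num) hy; norm_num at this
      rcases this with h | h <;> linarith)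
    have e4 := aux_pre1 μ hμI (zfun 3 ⁻¹' {1/2}) (1/2) (fun y hy a b => by
      have := pz4 a b (by norm_num) (by norm_num) hy; norm_num at this; linarith)
    have e5 := aux_pre0 μ hμI (zfun 4 ⁻¹' {1/2}) (fun y hy a b => by
      have := pz5 a b (by norm_num) (by norm_num) hy; norm_num at this)
    have e6 := aux_pre0 μ hμI (zfun 5 ⁻¹' {1/2}) (fun y hy a b => by
      have := pz6 a b (by norm_num) (by norm_num) hy; norm_num at this)
    linarith
  have hzero : μ.real {(0:ℝ)} ≤ μ.real {(1/2:ℝ)} := by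
    have e := inv_real μ hinv 0
    have e1 := aux_pre1 μ hμI (zfun 0 ⁻¹' {0}) 0 (fun y hy a b => by
      have := pz1 a b (by norm_num) (by norm_num) hy; norm_num at this; linarith)
    have e2 := aux_pre2 μ hμI (zfun 1 ⁻¹' {0}) 0 (1/2) (fun y hy a b => by
      have := pz2 a b (by norm_num) (by norm_num) hy; norm_num at this
      rcases this with h | h
      · left; linarith
      · right; linarith)
    have e3 := aux_pre1 μ hμI (zfun 2 ⁻¹' {0}) (1/2) (fun y hy a b => by
      have := pz3 a b (by norm_num) (by norm_num) hy; norm_num at this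
      linarith)
    have e4 := aux_pre0 μ hμI (zfun 3 ⁻¹' {0}) (fun y hy a b => by
      have := pz4 a b (by norm_num) (by norm_num) hy; norm_num at this)
    have e5 := aux_pre1 μ hμI (zfun 4 ⁻¹' {0}) (1/2) (fun y hy a b => by
      have := pz5 a b (by norm_num) (by norm_num) hy; norm_num at this; linarith)
    have e6 := aux_pre1 μ hμI (zfun 5 ⁻¹' {0}) (1/2) (fun y hy a b => by
      have := pz6 a b (by norm_num) (by norm_num) hy; norm_num at this; linarith)
    linarith
  have m27 := hmax (2/7)
  have m15 := hmax (1/5)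
  have hne0 : x ≠ 0 := by rintro rfl; linarith
  have hne1 : x ≠ 1/2 := by rintro rfl; linarith
  have hpos : 0 < x := lt_of_le_of_ne hx0 (Ne.symm hne0)
  have hlt : x < 1/2 := lt_of_le_of_ne hx1 hne1
  refine ⟨by rw [div_lt_iff₀ (by linarith)]; nlinarith, le_antisymm (hmax _) ?_⟩
  have e := inv_real μ hinv x
  have e1 := aux_pre1 μ hμI (zfun 0 ⁻¹' {x}) _ (fun y hy a b => pz1 a b hx0 hx1 hy)
  have e2 := aux_pre2 μ hμI (zfun 1 ⁻¹' {x}) _ _ (fun y hy a b =>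
    (pz2 a b hx0 hx1 hy).imp And.left And.left)
  have e3 := aux_pre2 μ hμI (zfun 2 ⁻¹' {x}) _ _ (fun y hy a b =>
    (pz3 a b hx0 hx1 hy).imp And.left And.left)
  have e3' : x < 1/3 → _ := fun hh => aux_pre1 μ hμI (zfun 2 ⁻¹' {x}) ((2-3*x)/(4-3*x))
    (fun y hy a b => by
      rcases pz3 a b hx0 hx1 hy with h | h
      · linarith
      · exact h.1)
  have e4 := aux_pre1 μ hμI (zfun 3 ⁻¹' {x}) _ (fun y hy a b => (pz4 a b hx0 hx1 hy).1)
  have e4' : x < 1/4 → _ := fun hh => aux_pre0 μ hμI (zfun 3 ⁻¹' {x})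
    (fun y hy a b => by linarith [(pz4 a b hx0 hx1 hy).2])
  have e5 := aux_pre1 μ hμI (zfun 4 ⁻¹' {x}) _ (fun y hy a b => (pz5 a b hx0 hx1 hy).1)
  have e5' : 1/4 < x → _ := fun hh => aux_pre0 μ hμI (zfun 4 ⁻¹' {x})
    (fun y hy a b => by linarith [(pz5 a b hx0 hx1 hy).2])
  have e6 := aux_pre1 μ hμI (zfun 5 ⁻¹' {x}) _ (fun y hy a b => (pz6 a b hx0 hx1 hy).1)
  have e6' : 1/3 < x → _ := fun hh => aux_pre0 μ hμI (zfun 5 ⁻¹' {x})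
    (fun y hy a b => by linarith [(pz6 a b hx0 hx1 hy).2])
  have m1 := hmax (2*x/(3+x))
  have m2 := hmax ((2-2*x)/(4-x))
  have m3 := hmax ((3*x-1)/(1+3*x))
  have m4 := hmax ((2-3*x)/(4-3*x))
  have m5 := hmax ((4*x-1)/(1+2*x))
  have m6 := hmax ((1-4*x)/(2-2*x))
  have m7 := hmax ((1-3*x)/2)
  rcases lt_trichotomy x (1/4) with h | h | h
  · have := e3' (by linarith)
    have := e4' h
    linarith
  · have := e3' (by linarith)
    subst h
    norm_num at *
    linarith
  · have := e5' h
    rcases lt_trichotomy x (1/3) with h' | h' | h'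
    · have := e3' h'
      linarith
    · subst h'
      norm_num at *
      linarith
    · have := e6' h'
      linarith

lemma fin_atoms (μ : Measure ℝ) [IsProbabilityMeasure μ] (c : ℝ) (hc : 0 < c) :
    {x : ℝ | c ≤ μ.real {x}}.Finite := by
  by_contra hinf
  obtain ⟨n, hn⟩ := exists_nat_gt (1 / c)
  obtain ⟨t, ht, hcard⟩ := Set.Infinite.exists_subset_card_eq hinf n
  have h1 : ∑ y ∈ t, c ≤ ∑ y ∈ t, μ.real {y} := Finset.sum_le_sum (fun y hy => ht hy)
  rw [sum_measureReal_singleton] at h1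
  have h2 : μ.real (t : Set ℝ) ≤ 1 := measureReal_le_one
  simp only [Finset.sum_const, hcard, nsmul_eq_mul] at h1
  rw [div_lt_iff₀ hc] at hn
  linarith

lemma no_atom_real (μ : Measure ℝ) [IsProbabilityMeasure μ]
    (hμI : μ (Set.Icc (0:ℝ) (1/2)) = 1) (hinv : MInvariant μ) (x : ℝ) : μ.real {x} = 0 := by
  by_contra hx
  have hc : 0 < μ.real {x} := lt_of_le_of_ne measureReal_nonneg (Ne.symm hx)
  obtain ⟨a, ha, hamax⟩ := Set.exists_max_image _ (fun y => μ.real {y})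
    (fin_atoms μ _ hc) ⟨x, le_refl (μ.real {x})⟩
  have hapos : 0 < μ.real {a} := lt_of_lt_of_le hc ha
  have hmax : ∀ y, μ.real {y} ≤ μ.real {a} := by
    intro y
    by_cases hy : μ.real {x} ≤ μ.real {y}
    · exact hamax y hy
    · exact (not_le.1 hy).le.trans ha
  obtain ⟨b, hb, hbmin⟩ := Set.exists_min_image _ (fun y : ℝ => y)
    (fin_atoms μ _ hapos) ⟨a, le_refl (μ.real {a})⟩
  obtain ⟨h1, h2⟩ := step μ hμI hinv _ hapos hmax b (le_antisymm (hmax b) hb)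
  have := hbmin _ (show μ.real {a} ≤ _ from h2.ge)
  linarith

/-- **The invariant measure has no atoms.** Every `M`-invariant probability measure on
`[0,1/2]` gives zero mass to every singleton; in particular `μ({0}) = 0`. -/
theorem MInvariant_no_atom
    (μ : Measure ℝ) (hμ : IsProbabilityMeasure μ)
    (hμI : μ (Set.Icc (0:ℝ) (1/2)) = 1) (hinv : MInvariant μ) :
    (∀ x : ℝ, μ {x} = 0) ∧ μ {(0:ℝ)} = 0 := by
  have h : ∀ x : ℝ, μ {x} = 0 := fun x =>
    (measureReal_eq_zero_iff (measure_ne_top _ _)).1 (no_atom_real μ hμI hinv x)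
  exact ⟨h, h 0⟩

end
end

section
/- Every M-invariant probability measure μ on [0,1/2] has support equal to the whole segment [0,1/2]. -/
open MeasureTheory ProbabilityTheory Filter Set

noncomputable section

theorem contr_aux (a b : ℝ) (ha : a ≤ 1/2) (hb : b ≤ 1/2) :
    |6 * (a - b) / ((4 - 2*a) * (4 - 2*b))| ≤ 2/3 * |a - b| := by
  have h : 9 ≤ (4 - 2*a) * (4 - 2*b) := by nlinarith
  rw [abs_div, abs_mul, abs_of_pos (by linarith : (0:ℝ) < (4 - 2*a) * (4 - 2*b)),
    div_le_iff₀ (by linarith), abs_of_pos (by norm_num : (0:ℝ) < 6)]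
  nlinarith [abs_nonneg (a - b)]

theorem ball_pos (μ : Measure ℝ) (hμ : IsProbabilityMeasure μ)
    (hμI : μ (Set.Icc (0:ℝ) (1/2)) = 1) (hinv : MInvariant μ) (n : ℕ) :
    ∀ y ∈ Set.Icc (0:ℝ) (1/2), μ (Metric.closedBall y ((2/3)^n)) ≠ 0 := by
  have hc : μ (Set.Icc (0:ℝ) (1/2))ᶜ = 0 := by
    rw [prob_compl_eq_zero_iff measurableSet_Icc]; exact hμI
  induction n with
  | zero =>
    intro y hy h
    have : μ (Set.Icc (0:ℝ) (1/2)) = 0 := by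
      refine measure_mono_null ?_ h
      intro x hx
      simp only [Metric.mem_closedBall, Real.dist_eq, pow_zero, abs_le]
      constructor <;> linarith [hx.1, hx.2, hy.1, hy.2]
    rw [hμI] at this
    exact one_ne_zero this
  | succ n ih =>
    intro y hy h
    have key : ∀ (i : Fin 6) (x : ℝ), x ∈ Set.Icc (0:ℝ) (1/2) →
        (∀ s ∈ Set.Icc (0:ℝ) (1/2), |zfun i s - y| ≤ 2/3 * |s - x|) → False := by
      intro i x hx hs
      apply ih x hx
      have h0 := hinv _ (Metric.isClosed_closedBall (x := y) (ε := (2/3)^(n+1))).measurableSet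
      rw [h, eq_comm, mul_eq_zero] at h0
      have h1 := h0.resolve_left (by simp)
      rw [Finset.sum_eq_zero_iff] at h1
      refine measure_mono_null ?_ (measure_union_null (h1 i (Finset.mem_univ _)) hc)
      intro s hsb
      by_cases hsI : s ∈ Set.Icc (0:ℝ) (1/2)
      · left
        simp only [Set.mem_preimage, Metric.mem_closedBall, Real.dist_eq] at hsb ⊢
        have := hs s hsI
        rw [pow_succ]
        linarith
      · exact Or.inr hsI
    obtain ⟨hy0, hy1⟩ := hy
    rcases le_total y (1/4) with h4 | h4
    · have hx2 : (1-4*y)/(2-2*y) ≤ 1/2 := by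
        rw [div_le_iff₀ (by linarith)]; linarith
      refine key 4 ((1-4*y)/(2-2*y)) ⟨div_nonneg (by linarith) (by linarith), hx2⟩ ?_
      intro s hs
      have e : zfun 4 s - y = -(6 * (s - (1-4*y)/(2-2*y)) /
          ((4 - 2*s) * (4 - 2*((1-4*y)/(2-2*y))))) := by
        have h5 : 1-y ≠ 0 := by linarith
        have e1 : 4 - 2*((1-4*y)/(2-2*y)) = 6/(2-2*y) := by
          have : 2-2*y ≠ 0 := by linarith
          field_simp; ring
        have h1 : 2-2*y ≠ 0 := by linarith
        have h2 : 4-2*s ≠ 0 := by linarith [hs.2]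
        have h3 : 2-s ≠ 0 := by linarith [hs.2]
        rw [e1]
        change (1-2*s)/(4-2*s) - y = _
        field_simp; ring
      rw [e, abs_neg]
      exact contr_aux _ _ hs.2 hx2
    · have hx2 : (4*y-1)/(1+2*y) ≤ 1/2 := by
        rw [div_le_iff₀ (by linarith)]; linarith
      refine key 3 ((4*y-1)/(1+2*y)) ⟨div_nonneg (by linarith) (by linarith), hx2⟩ ?_
      intro s hs
      have e : zfun 3 s - y = (6 * (s - (4*y-1)/(1+2*y)) /
          ((4 - 2*s) * (4 - 2*((4*y-1)/(1+2*y))))) := by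
        have h1 : 1+2*y ≠ 0 := by linarith
        have e1 : 4 - 2*((4*y-1)/(1+2*y)) = 6/(1+2*y) := by
          field_simp; ring
        have h2 : 4-2*s ≠ 0 := by linarith [hs.2]
        have h3 : 2-s ≠ 0 := by linarith [hs.2]
        rw [e1]
        change (1+s)/(4-2*s) - y = _
        rw [show 4 - 2*s = 2*(2-s) by ring]
        field_simp; ring
      rw [e]
      exact contr_aux _ _ hs.2 hx2

/-- **Full support of the invariant measure.** Every `M`-invariant probability measure on
`[0,1/2]` has support (the smallest closed set of full measure) equal to `[0,1/2]`. -/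
theorem MInvariant_full_support
    (μ : Measure ℝ) (hμ : IsProbabilityMeasure μ)
    (hμI : μ (Set.Icc (0:ℝ) (1/2)) = 1) (hinv : MInvariant μ) :
    ⋂₀ {C : Set ℝ | IsClosed C ∧ μ Cᶜ = 0} = Set.Icc (0:ℝ) (1/2) := by
  apply Set.Subset.antisymm
  · apply Set.sInter_subset_of_mem
    exact ⟨isClosed_Icc, by rw [prob_compl_eq_zero_iff measurableSet_Icc]; exact hμI⟩
  · rintro y hy C ⟨hC, h0⟩
    by_contra hyC
    obtain ⟨ε, hε, hb⟩ := Metric.isOpen_iff.1 hC.isOpen_compl y hyC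
    obtain ⟨n, hn⟩ := exists_pow_lt_of_lt_one hε (by norm_num : (2/3:ℝ) < 1)
    exact ball_pos μ hμ hμI hinv n y hy
      (measure_mono_null ((Metric.closedBall_subset_ball hn).trans hb) h0)

end
end

section
/- For every a ∈ [0,1/2] and every ε > 0, there exist an integer N ≥ 1 and a real η > 0 such that for every z ∈ [0,1/2], M^N(z, [a−ε, a+ε] ∩ [0,1/2]) ≥ η; equivalently, the flat chain started from any point z reaches the ε-neighbourhood of a at time N with probability at least η. -/
open MeasureTheory ProbabilityTheory Filter Set

noncomputable section

lemma aux_step (ν : Measure ℝ) (i : Fin 6) (hm : Measurable (zfun i)) (B C : Set ℝ)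
    (hB : MeasurableSet B) (h : C ⊆ zfun i ⁻¹' B) :
    (6 : ENNReal)⁻¹ * ν C ≤ Mstep ν B := by
  have h1 : Mstep ν B = ∑ i : Fin 6, (6 : ENNReal)⁻¹ * ν.map (zfun i) B := by
    simp [Mstep, Measure.finsetSum_apply]
  rw [h1]
  refine le_trans ?_ (Finset.single_le_sum
    (f := fun i : Fin 6 => (6 : ENNReal)⁻¹ * ν.map (zfun i) B)
    (fun _ _ => zero_le) (Finset.mem_univ i))
  rw [Measure.map_apply hm hB]
  gcongr

lemma aux_z4 : zfun 3 = fun x => (1+x)/(4-2*x) := rfl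

lemma aux_z5 : zfun 4 = fun x => (1-2*x)/(4-2*x) := rfl

lemma aux_cover (a : ℝ) (ha : a ∈ Set.Icc (0:ℝ) (1/2)) :
    ∃ i : Fin 6, Measurable (zfun i) ∧ ∃ b ∈ Set.Icc (0:ℝ) (1/2),
      ∀ x ∈ Set.Icc (0:ℝ) (1/2), zfun i x ∈ Set.Icc (0:ℝ) (1/2) ∧
        |zfun i x - a| ≤ 2/3 * |x - b| := by
  obtain ⟨ha0, ha1⟩ := ha
  have key : ∀ x b : ℝ, x ≤ 1/2 → b ≤ 1/2 → |6 / ((4-2*x)*(4-2*b))| ≤ 2/3 := by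
    intro x b hx hb
    have : 0 < (4-2*x)*(4-2*b) := by apply mul_pos <;> linarith
    rw [abs_of_pos (by positivity), div_le_iff₀ this]
    nlinarith
  rcases le_total (1/4) a with h | h
  · refine ⟨3, by rw [aux_z4]; fun_prop, (4*a-1)/(1+2*a), ⟨?_, ?_⟩, ?_⟩
    · apply div_nonneg <;> linarith
    · rw [div_le_iff₀ (by linarith)]; linarith
    · rintro x ⟨hx0, hx1⟩
      have hb : (4*a-1)/(1+2*a) ≤ 1/2 := by rw [div_le_iff₀ (by linarith)]; linarith
      set b := (4*a-1)/(1+2*a) with hbd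
      have hab : a = (1+b)/(4-2*b) := by
        rw [eq_div_iff (by linarith)]
        have : b * (1+2*a) = 4*a-1 := by rw [hbd]; exact div_mul_cancel₀ _ (by linarith)
        linarith
      rw [aux_z4]
      refine ⟨⟨?_, ?_⟩, ?_⟩
      · apply div_nonneg <;> linarith
      · simp only; rw [div_le_iff₀ (by linarith)]; linarith
      · have e : (1+x)/(4-2*x) - a = 6 / ((4-2*x)*(4-2*b)) * (x - b) := by
          have h1 : 4-2*x ≠ 0 := by linarith
          have h2 : 4-2*b ≠ 0 := by linarith
          rw [hab, div_sub_div _ _ h1 h2, div_mul_eq_mul_div]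
          congr 1; ring
        simp only
        rw [e, abs_mul]
        exact mul_le_mul_of_nonneg_right (key x b hx1 hb) (abs_nonneg _)
  · refine ⟨4, by rw [aux_z5]; fun_prop, (1-4*a)/(2-2*a), ⟨?_, ?_⟩, ?_⟩
    · apply div_nonneg <;> linarith
    · rw [div_le_iff₀ (by linarith)]; linarith
    · rintro x ⟨hx0, hx1⟩
      have hb : (1-4*a)/(2-2*a) ≤ 1/2 := by rw [div_le_iff₀ (by linarith)]; linarith
      set b := (1-4*a)/(2-2*a) with hbd
      have hab : a = (1-2*b)/(4-2*b) := by
        rw [eq_div_iff (by linarith)]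
        have : b * (2-2*a) = 1-4*a := by rw [hbd]; exact div_mul_cancel₀ _ (by linarith)
        linarith
      rw [aux_z5]
      refine ⟨⟨?_, ?_⟩, ?_⟩
      · apply div_nonneg <;> linarith
      · simp only; rw [div_le_iff₀ (by linarith)]; linarith
      · have e : (1-2*x)/(4-2*x) - a = 6 / ((4-2*x)*(4-2*b)) * (b - x) := by
          have h1 : 4-2*x ≠ 0 := by linarith
          have h2 : 4-2*b ≠ 0 := by linarith
          rw [hab, div_sub_div _ _ h1 h2, div_mul_eq_mul_div]
          congr 1; ring
        simp only
        rw [e, abs_mul, abs_sub_comm b x]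
        exact mul_le_mul_of_nonneg_right (key x b hx1 hb) (abs_nonneg _)

lemma aux_iter (z : ℝ) (hz : z ∈ Set.Icc (0:ℝ) (1/2)) (n : ℕ) :
    ∀ a ∈ Set.Icc (0:ℝ) (1/2), ((6 : ENNReal)⁻¹)^n ≤ Mstep^[n] (Measure.dirac z)
      (Set.Icc (a-(2/3)^n) (a+(2/3)^n) ∩ Set.Icc (0:ℝ) (1/2)) := by
  induction n with
  | zero =>
    rintro a ⟨ha0, ha1⟩
    have : z ∈ Set.Icc (a-(2/3)^0) (a+(2/3)^0) ∩ Set.Icc (0:ℝ) (1/2) := by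
      refine ⟨⟨?_, ?_⟩, hz⟩ <;> norm_num <;> linarith [hz.1, hz.2]
    rw [Function.iterate_zero_apply, Measure.dirac_apply_of_mem this]
    simp
  | succ n ih =>
    intro a ha
    obtain ⟨i, hm, b, hb, h⟩ := aux_cover a ha
    rw [Function.iterate_succ_apply', pow_succ']
    refine le_trans (mul_le_mul_right (ih b hb) _) (aux_step _ i hm _ _
      (measurableSet_Icc.inter measurableSet_Icc) ?_)
    rintro x ⟨⟨hx1, hx2⟩, hx⟩
    obtain ⟨h1, h2⟩ := h x hx
    have h3 : |x - b| ≤ (2/3)^n := abs_le.2 ⟨by linarith, by linarith⟩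
    have h4 : |zfun i x - a| ≤ (2/3)^(n+1) := by rw [pow_succ']; linarith
    obtain ⟨h5, h6⟩ := abs_le.1 h4
    exact ⟨⟨by linarith, by linarith⟩, h1⟩

/-- **Uniform hitting of neighbourhoods.** For every `a ∈ [0,1/2]` and `ε > 0` there are
`N ≥ 1` and `η > 0` such that from every starting point `z ∈ [0,1/2]`, the flat chain is
in `[a−ε, a+ε] ∩ [0,1/2]` at time `N` with probability at least `η`. -/
theorem flat_chain_uniform_hitting :
    ∀ a ∈ Set.Icc (0:ℝ) (1/2), ∀ ε : ℝ, 0 < ε →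
      ∃ N : ℕ, 1 ≤ N ∧ ∃ η : ℝ, 0 < η ∧
        ∀ z ∈ Set.Icc (0:ℝ) (1/2),
          ENNReal.ofReal η ≤
            Mstep^[N] (Measure.dirac z)
              (Set.Icc (a-ε) (a+ε) ∩ Set.Icc (0:ℝ) (1/2)) := by
  intro a ha ε hε
  obtain ⟨n, hn⟩ := exists_pow_lt_of_lt_one hε (show (2/3 : ℝ) < 1 by norm_num)
  have hn' : (2/3 : ℝ)^(n+1) ≤ ε := by
    have : (0:ℝ) < (2/3)^n := by positivity
    rw [pow_succ]; linarith
  refine ⟨n+1, by omega, (6⁻¹)^(n+1), by positivity, fun z hz => ?_⟩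
  have e : ENNReal.ofReal ((6⁻¹ : ℝ)^(n+1)) = ((6 : ENNReal)⁻¹)^(n+1) := by
    rw [ENNReal.ofReal_pow (by norm_num), ENNReal.ofReal_inv_of_pos (by norm_num)]
    norm_num
  rw [e]
  refine (aux_iter z hz (n+1) a ha).trans (measure_mono ?_)
  exact Set.inter_subset_inter_left _ (Set.Icc_subset_Icc (by linarith) (by linarith))

end
end
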